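/- arXiv:0801.2486 — 4 statements merged into one kernel-verified Lean document; each statement's English description precedes it below -/
import Mathlib

section
/- Let K₀ = {f ∈ C([0,1]) : ‖f‖∞ ≤ 1 and f is 1-Lipschitz}. If a real Banach space Y contains an isometric copy of K₀ (i.e., there exists a distance-preserving map from K₀ into Y), then for every separable real Banach space X there exists a linear isometric embedding of X into Y. -/
universe u

open Set Filter Topology Pointwise Finset

section ConvexScaling

variable {E : Type*} [AddCommGroup E] [Module ℝ E] {K : Set E}

lemma Convex.smul_subset_smul_of_le (hK : Convex ℝ K) (h0 : (0 : E) ∈ K) {a b : ℝ}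
    (ha : 0 ≤ a) (hab : a ≤ b) : a • K ⊆ b • K := by
  intro x hx
  have h : (a + (b - a)) • K = a • K + (b - a) • K := hK.add_smul ha (sub_nonneg.2 hab)
  rw [add_sub_cancel] at h
  rw [h]
  exact ⟨x, hx, 0, ⟨0, h0, smul_zero _⟩, add_zero x⟩

lemma Convex.add_mem_smul (hK : Convex ℝ K) {a b : ℝ} (ha : 0 ≤ a) (hb : 0 ≤ b) {x y : E}
    (hx : x ∈ a • K) (hy : y ∈ b • K) : x + y ∈ (a + b) • K := by
  rw [hK.add_smul ha hb]
  exact Set.add_mem_add hx hy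

end ConvexScaling

section PointMass

variable {E : Type*}

/-- The point mass at `x`, as an element of the additive group algebra of `E`. -/
noncomputable def pointMass (x : E) : AddMonoidAlgebra ℝ E := AddMonoidAlgebra.single x 1

/-- The finitely supported probability measures carried by `S`. -/
def finiteProbabilities (S : Set E) : Set (AddMonoidAlgebra ℝ E) :=
  convexHull ℝ (pointMass '' S)

lemma pointMass_mem_finiteProbabilities {S : Set E} {x : E} (hx : x ∈ S) :
    pointMass x ∈ finiteProbabilities S :=
  subset_convexHull ℝ _ (mem_image_of_mem _ hx)

lemma finiteProbabilities_mono {S T : Set E} (h : S ⊆ T) :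
    finiteProbabilities S ⊆ finiteProbabilities T :=
  convexHull_mono (image_mono h)

lemma map_mem_of_mem_finiteProbabilities {V : Type*} [AddCommGroup V] [Module ℝ V]
    (L : AddMonoidAlgebra ℝ E →ₗ[ℝ] V) {C : Set V} (hC : Convex ℝ C) {S : Set E}
    (h : ∀ s ∈ S, L (pointMass s) ∈ C) {p : AddMonoidAlgebra ℝ E}
    (hp : p ∈ finiteProbabilities S) : L p ∈ C :=
  convexHull_min (t := L ⁻¹' C) (image_subset_iff.2 h) (hC.linear_preimage L) hp

/-- Integration of a vector-valued map against finitely supported measures. -/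
noncomputable def integrate {Y : Type*} [AddCommGroup Y] [Module ℝ Y] (j : E → Y) :
    AddMonoidAlgebra ℝ E →ₗ[ℝ] Y :=
  Finsupp.linearCombination ℝ j ∘ₗ (AddMonoidAlgebra.coeffLinearEquiv ℝ).toLinearMap

lemma integrate_pointMass {Y : Type*} [AddCommGroup Y] [Module ℝ Y] (j : E → Y) (x : E) :
    integrate j (pointMass x) = j x := by
  simp [integrate, pointMass]

variable [AddCommGroup E]

lemma pointMass_zero : pointMass (0 : E) = 1 := (AddMonoidAlgebra.one_def).symm

lemma pointMass_add (x y : E) : pointMass (x + y) = pointMass x * pointMass y := by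
  simp [pointMass, AddMonoidAlgebra.single_mul_single]

lemma pointMass_nsmul (n : ℕ) (x : E) : pointMass (n • x) = pointMass x ^ n := by
  simp [pointMass, AddMonoidAlgebra.single_pow]

lemma mul_mem_finiteProbabilities {S T : Set E} {p q : AddMonoidAlgebra ℝ E}
    (hp : p ∈ finiteProbabilities S) (hq : q ∈ finiteProbabilities T) :
    p * q ∈ finiteProbabilities (S + T) := by
  refine map_mem_of_mem_finiteProbabilities (LinearMap.mulRight ℝ q) (convex_convexHull ℝ _)
    (fun s hs => ?_) hp
  refine map_mem_of_mem_finiteProbabilities (LinearMap.mulLeft ℝ (pointMass s))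
    (convex_convexHull ℝ _) (fun t ht => ?_) hq
  rw [LinearMap.mulLeft_apply, ← pointMass_add]
  exact pointMass_mem_finiteProbabilities (Set.add_mem_add hs ht)

/-- Integration against `p` of the increment of `j` in direction `a`. -/
noncomputable def meanIncrement {Y : Type*} [AddCommGroup Y] [Module ℝ Y] (j : E → Y) (a : E) :
    AddMonoidAlgebra ℝ E →ₗ[ℝ] Y :=
  integrate j ∘ₗ LinearMap.mulLeft ℝ (pointMass a - 1)

lemma meanIncrement_apply {Y : Type*} [AddCommGroup Y] [Module ℝ Y] (j : E → Y) (a : E)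
    (p : AddMonoidAlgebra ℝ E) : meanIncrement j a p = integrate j ((pointMass a - 1) * p) := rfl

lemma meanIncrement_pointMass {Y : Type*} [AddCommGroup Y] [Module ℝ Y] (j : E → Y) (a s : E) :
    meanIncrement j a (pointMass s) = j (a + s) - j s := by
  rw [meanIncrement_apply, sub_mul, one_mul, ← pointMass_add, map_sub, integrate_pointMass,
    integrate_pointMass]

variable [Module ℝ E]

/-- The uniform average of the point masses at `0, N⁻¹ • v, …, (N - 1) • N⁻¹ • v`. -/
noncomputable def segmentAverage (N : ℕ) (v : E) : AddMonoidAlgebra ℝ E :=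
  (N : ℝ)⁻¹ • ∑ i ∈ range N, pointMass ((N : ℝ)⁻¹ • v) ^ i

lemma segmentAverage_mem {N : ℕ} (hN : N ≠ 0) {S : Set E} (hS : Convex ℝ S)
    (h0 : (0 : E) ∈ S) {v : E} (hv : v ∈ S) : segmentAverage N v ∈ finiteProbabilities S := by
  have hN' : (0 : ℝ) < N := by positivity
  rw [segmentAverage, smul_sum]
  refine (convex_convexHull ℝ _).sum_mem (fun _ _ => by positivity) ?_ (fun i hi => ?_)
  · simp [hN'.ne']
  · rw [← pointMass_nsmul]
    apply pointMass_mem_finiteProbabilities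
    rw [← Nat.cast_smul_eq_nsmul ℝ, smul_smul]
    refine hS.smul_mem_of_zero_mem h0 hv ⟨by positivity, ?_⟩
    rw [← div_eq_mul_inv, div_le_one hN']
    exact_mod_cast (Finset.mem_range.1 hi).le

lemma sub_one_mul_segmentAverage {N : ℕ} (hN : N ≠ 0) (v : E) :
    (pointMass ((N : ℝ)⁻¹ • v) - 1) * segmentAverage N v = (N : ℝ)⁻¹ • (pointMass v - 1) := by
  rw [segmentAverage, mul_smul_comm, mul_geom_sum, ← pointMass_nsmul,
    ← Nat.cast_smul_eq_nsmul ℝ, smul_inv_smul₀ (Nat.cast_ne_zero.2 hN)]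

/-- The average over the cube spanned by the vectors `x n` with `n ∈ F`, on a grid of mesh `1/N`. -/
noncomputable def cubeAverage (x : ℕ → E) (N : ℕ) (F : Finset ℕ) : AddMonoidAlgebra ℝ E :=
  ∏ n ∈ F, segmentAverage N (x n)

lemma cubeAverage_mem {K : Set E} (hK : Convex ℝ K) (h0 : (0 : E) ∈ K) {x : ℕ → E} {c : ℕ → ℝ}
    (hc : ∀ n, 0 ≤ c n) (hx : ∀ n, x n ∈ c n • K) {N : ℕ} (hN : N ≠ 0) (F : Finset ℕ) :
    cubeAverage x N F ∈ finiteProbabilities ((∑ n ∈ F, c n) • K) := by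
  have hz : ∀ a : ℝ, (0 : E) ∈ a • K := fun a => ⟨0, h0, smul_zero a⟩
  induction F using Finset.induction_on with
  | empty =>
    rw [cubeAverage, Finset.prod_empty, ← pointMass_zero]
    exact pointMass_mem_finiteProbabilities (hz _)
  | insert n F hn ih =>
    rw [cubeAverage, Finset.prod_insert hn, Finset.sum_insert hn,
      hK.add_smul (hc n) (Finset.sum_nonneg fun _ _ => hc _)]
    exact mul_mem_finiteProbabilities (segmentAverage_mem hN (hK.smul _) (hz _) (hx n)) ih

lemma sub_one_mul_cubeAverage (x : ℕ → E) {N : ℕ} (hN : N ≠ 0) {F : Finset ℕ} {n : ℕ}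
    (hn : n ∈ F) : (pointMass ((N : ℝ)⁻¹ • x n) - 1) * cubeAverage x N F =
      (N : ℝ)⁻¹ • ((pointMass (x n) - 1) * cubeAverage x N (F.erase n)) := by
  rw [cubeAverage, ← Finset.mul_prod_erase F _ hn, ← mul_assoc, sub_one_mul_segmentAverage hN,
    smul_mul_assoc, cubeAverage]

/-- The difference quotient of `j` at scale `1/N` in direction `g`, averaged over the cube spanned
by `x 0, …, x (N - 1)`. -/
noncomputable def meanQuotient {Y : Type*} [AddCommGroup Y] [Module ℝ Y] (j : E → Y) (x : ℕ → E)
    (N : ℕ) (g : E) : Y :=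
  (N : ℝ) • meanIncrement j ((N : ℝ)⁻¹ • g) (cubeAverage x N (range N))

lemma meanQuotient_zero {Y : Type*} [AddCommGroup Y] [Module ℝ Y] (j : E → Y) (x : ℕ → E)
    (N : ℕ) : meanQuotient j x N 0 = 0 := by
  simp [meanQuotient, meanIncrement_apply, pointMass_zero]

lemma meanQuotient_basis {Y : Type*} [AddCommGroup Y] [Module ℝ Y] (j : E → Y) (x : ℕ → E)
    {N n : ℕ} (hn : n < N) :
    meanQuotient j x N (x n) = meanIncrement j (x n) (cubeAverage x N ((range N).erase n)) := by
  have hN : N ≠ 0 := by omega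
  rw [meanQuotient, meanIncrement_apply, meanIncrement_apply,
    sub_one_mul_cubeAverage x hN (Finset.mem_range.2 hn), map_smul,
    smul_inv_smul₀ (Nat.cast_ne_zero.2 hN)]

lemma meanQuotient_add_basis {Y : Type*} [AddCommGroup Y] [Module ℝ Y] (j : E → Y) (x : ℕ → E)
    {N n : ℕ} (hn : n < N) (g : E) :
    meanQuotient j x N (g + x n) - meanQuotient j x N g - meanQuotient j x N (x n) =
      meanIncrement j ((N : ℝ)⁻¹ • g)
        (pointMass (x n) * cubeAverage x N ((range N).erase n)) -
      meanIncrement j ((N : ℝ)⁻¹ • g) (cubeAverage x N ((range N).erase n)) := by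
  have hN : N ≠ 0 := by omega
  have key := sub_one_mul_cubeAverage x hN (Finset.mem_range.2 hn)
  rw [← map_sub, meanQuotient, meanQuotient, meanQuotient, ← smul_sub, ← smul_sub]
  simp only [meanIncrement_apply]
  rw [← map_sub, ← map_sub, ← map_smul, smul_add, pointMass_add]
  congr 1
  set P := cubeAverage x N (range N)
  set Q := cubeAverage x N ((range N).erase n)
  calc _ = (N : ℝ) • ((pointMass ((N : ℝ)⁻¹ • g) - 1) *
        ((pointMass ((N : ℝ)⁻¹ • x n) - 1) * P)) := by congr 1; ring
    _ = (pointMass ((N : ℝ)⁻¹ • g) - 1) * ((pointMass (x n) - 1) * Q) := by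
      rw [key, mul_smul_comm, smul_inv_smul₀ (Nat.cast_ne_zero.2 hN)]
    _ = _ := by ring

end PointMass

section Increments

variable {E Y : Type*} [NormedAddCommGroup E] [NormedAddCommGroup Y]
  [NormedSpace ℝ Y] {K : Set E} {j : E → Y}

lemma norm_meanIncrement_le (hj : ∀ x ∈ K, ∀ y ∈ K, ‖j x - j y‖ = ‖x - y‖) {S : Set E} {a : E}
    (hS : S ⊆ K) (haS : ∀ s ∈ S, a + s ∈ K) {p : AddMonoidAlgebra ℝ E}
    (hp : p ∈ finiteProbabilities S) : ‖meanIncrement j a p‖ ≤ ‖a‖ := by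
  rw [← mem_closedBall_zero_iff]
  refine map_mem_of_mem_finiteProbabilities _ (convex_closedBall _ _) (fun s hs => ?_) hp
  rw [mem_closedBall_zero_iff, meanIncrement_pointMass, hj _ (haS s hs) _ (hS hs),
    add_sub_cancel_right]

lemma map_meanIncrement_eq [NormedSpace ℝ E] {L : Y →L[ℝ] ℝ} {e : E →ₗ[ℝ] ℝ}
    (h : ∀ f ∈ K, L (j f) = e f) {S : Set E} {a : E} (hS : S ⊆ K) (haS : ∀ s ∈ S, a + s ∈ K)
    {p : AddMonoidAlgebra ℝ E} (hp : p ∈ finiteProbabilities S) :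
    L (meanIncrement j a p) = e a := by
  refine map_mem_of_mem_finiteProbabilities (L.toLinearMap ∘ₗ meanIncrement j a)
    (convex_singleton (e a)) (fun s hs => ?_) hp
  simp [meanIncrement_pointMass, h _ (haS s hs), h _ (hS hs)]

lemma meanIncrement_mem_convexHull {S : Set E} {a : E} (hS : S ⊆ K) (haS : ∀ s ∈ S, a + s ∈ K)
    {p : AddMonoidAlgebra ℝ E} (hp : p ∈ finiteProbabilities S) :
    meanIncrement j a p ∈ convexHull ℝ (j '' K - j '' K) := by
  refine map_mem_of_mem_finiteProbabilities _ (convex_convexHull ℝ _) (fun s hs => ?_) hp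
  rw [meanIncrement_pointMass]
  exact subset_convexHull ℝ _
    (Set.sub_mem_sub (mem_image_of_mem _ (haS s hs)) (mem_image_of_mem _ (hS hs)))

end Increments

section Linearization

variable {E Y : Type*} [NormedAddCommGroup E] [NormedSpace ℝ E] [NormedAddCommGroup Y]
  [NormedSpace ℝ Y] {K : Set E} {j : E → Y} {x : ℕ → E} {c : ℕ → ℝ}

lemma eventually_inv_smul_mem (hK : Convex ℝ K) (h0 : (0 : E) ∈ K) {g : E}
    (hg : ∃ r : ℝ, 0 ≤ r ∧ g ∈ r • K) {ε : ℝ} (hε : 0 < ε) :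
    ∀ᶠ N : ℕ in atTop, (N : ℝ)⁻¹ • g ∈ ε • K := by
  obtain ⟨r, hr, hg⟩ := hg
  have hlim : Tendsto (fun N : ℕ => (N : ℝ)⁻¹ * r) atTop (𝓝 0) := by
    simpa using tendsto_inv_atTop_nhds_zero_nat.mul_const r
  filter_upwards [hlim.eventually (gt_mem_nhds hε)] with N hN
  refine hK.smul_subset_smul_of_le h0 (by positivity) hN.le ?_
  rw [mul_smul]
  exact Set.smul_mem_smul_set hg

lemma half_smul_subset (hK : Convex ℝ K) (h0 : (0 : E) ∈ K) : (1 / 2 : ℝ) • K ⊆ K := by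
  simpa using hK.smul_subset_smul_of_le h0 (by norm_num) (by norm_num : (1 / 2 : ℝ) ≤ 1)

lemma add_mem_of_mem_half_smul (hK : Convex ℝ K) {a s : E} (ha : a ∈ (1 / 2 : ℝ) • K)
    (hs : s ∈ (1 / 2 : ℝ) • K) : a + s ∈ K := by
  have := hK.add_mem_smul (by norm_num) (by norm_num) ha hs
  norm_num at this
  simpa using this

lemma cubeAverage_mem_half (hK : Convex ℝ K) (h0 : (0 : E) ∈ K) (hc : ∀ n, 0 ≤ c n)
    (hsum : ∀ F : Finset ℕ, ∑ n ∈ F, c n ≤ 1 / 2) (hx : ∀ n, x n ∈ c n • K) {N : ℕ} (hN : N ≠ 0)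
    (F : Finset ℕ) : cubeAverage x N F ∈ finiteProbabilities ((1 / 2 : ℝ) • K) :=
  finiteProbabilities_mono
    (hK.smul_subset_smul_of_le h0 (Finset.sum_nonneg fun _ _ => hc _) (hsum F))
    (cubeAverage_mem hK h0 hc hx hN F)

lemma mem_half_smul_of_sum_le (hK : Convex ℝ K) (h0 : (0 : E) ∈ K) (hc : ∀ n, 0 ≤ c n)
    (hsum : ∀ F : Finset ℕ, ∑ n ∈ F, c n ≤ 1 / 2) (hx : ∀ n, x n ∈ c n • K) (n : ℕ) :
    x n ∈ (1 / 2 : ℝ) • K :=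
  hK.smul_subset_smul_of_le h0 (hc n) (by simpa using hsum {n}) (hx n)

lemma eventually_norm_meanQuotient_le (hK : Convex ℝ K) (h0 : (0 : E) ∈ K)
    (hj : ∀ x ∈ K, ∀ y ∈ K, ‖j x - j y‖ = ‖x - y‖) (hc : ∀ n, 0 ≤ c n)
    (hsum : ∀ F : Finset ℕ, ∑ n ∈ F, c n ≤ 1 / 2) (hx : ∀ n, x n ∈ c n • K) {g : E}
    (hg : ∃ r : ℝ, 0 ≤ r ∧ g ∈ r • K) :
    ∀ᶠ N : ℕ in atTop, ‖meanQuotient j x N g‖ ≤ ‖g‖ := by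
  filter_upwards [eventually_inv_smul_mem hK h0 hg (by norm_num : (0 : ℝ) < 1 / 2),
    eventually_ne_atTop 0] with N hN hN0
  have := norm_meanIncrement_le hj (half_smul_subset hK h0)
    (fun s hs => add_mem_of_mem_half_smul hK hN hs)
    (cubeAverage_mem_half hK h0 hc hsum hx hN0 (range N))
  have hpos : (0 : ℝ) < N := by positivity
  rw [norm_smul, norm_inv, RCLike.norm_natCast] at this
  rw [meanQuotient, norm_smul, RCLike.norm_natCast]
  calc _ ≤ (N : ℝ) * ((N : ℝ)⁻¹ * ‖g‖) := by gcongr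
    _ = ‖g‖ := by field_simp

lemma eventually_map_meanQuotient_eq (hK : Convex ℝ K) (h0 : (0 : E) ∈ K) {L : Y →L[ℝ] ℝ}
    {e : E →ₗ[ℝ] ℝ} (h : ∀ f ∈ K, L (j f) = e f) (hc : ∀ n, 0 ≤ c n)
    (hsum : ∀ F : Finset ℕ, ∑ n ∈ F, c n ≤ 1 / 2) (hx : ∀ n, x n ∈ c n • K) {g : E}
    (hg : ∃ r : ℝ, 0 ≤ r ∧ g ∈ r • K) :
    ∀ᶠ N : ℕ in atTop, L (meanQuotient j x N g) = e g := by
  filter_upwards [eventually_inv_smul_mem hK h0 hg (by norm_num : (0 : ℝ) < 1 / 2),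
    eventually_ne_atTop 0] with N hN hN0
  rw [meanQuotient, map_smul, map_meanIncrement_eq h (half_smul_subset hK h0)
    (fun s hs => add_mem_of_mem_half_smul hK hN hs)
    (cubeAverage_mem_half hK h0 hc hsum hx hN0 (range N)), map_smul,
    smul_inv_smul₀ (Nat.cast_ne_zero.2 hN0)]

lemma eventually_meanQuotient_basis_mem (hK : Convex ℝ K) (h0 : (0 : E) ∈ K) (hc : ∀ n, 0 ≤ c n)
    (hsum : ∀ F : Finset ℕ, ∑ n ∈ F, c n ≤ 1 / 2) (hx : ∀ n, x n ∈ c n • K) (n : ℕ) :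
    ∀ᶠ N : ℕ in atTop, meanQuotient j x N (x n) ∈ convexHull ℝ (j '' K - j '' K) := by
  filter_upwards [eventually_gt_atTop n] with N hN
  rw [meanQuotient_basis j x hN]
  exact meanIncrement_mem_convexHull (half_smul_subset hK h0)
    (fun s hs => add_mem_of_mem_half_smul hK (mem_half_smul_of_sum_le hK h0 hc hsum hx n) hs)
    (cubeAverage_mem_half hK h0 hc hsum hx (by omega) _)

lemma tendsto_meanQuotient_add_basis (hK : Convex ℝ K) (h0 : (0 : E) ∈ K)
    (hj : ∀ x ∈ K, ∀ y ∈ K, ‖j x - j y‖ = ‖x - y‖) (hc : ∀ n, 0 ≤ c n)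
    (hsum : ∀ F : Finset ℕ, ∑ n ∈ F, c n ≤ 1 / 2) (hx : ∀ n, x n ∈ c n • K) {g : E}
    (hg : ∃ r : ℝ, 0 ≤ r ∧ g ∈ r • K) (n : ℕ) :
    Tendsto (fun N => meanQuotient j x N (g + x n) - meanQuotient j x N g -
      meanQuotient j x N (x n)) atTop (𝓝 0) := by
  have hlim : Tendsto (fun N : ℕ => 2 * ((N : ℝ)⁻¹ * ‖g‖)) atTop (𝓝 0) := by
    simpa using (tendsto_inv_atTop_nhds_zero_nat.mul_const ‖g‖).const_mul (2 : ℝ)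
  refine squeeze_zero_norm' ?_ hlim
  filter_upwards [eventually_inv_smul_mem hK h0 hg (by norm_num : (0 : ℝ) < 1 / 2),
    eventually_gt_atTop n] with N hN hnN
  have hN0 : N ≠ 0 := by omega
  have hbound : ∀ p ∈ finiteProbabilities ((1 / 2 : ℝ) • K),
      ‖meanIncrement j ((N : ℝ)⁻¹ • g) p‖ ≤ (N : ℝ)⁻¹ * ‖g‖ := fun p hp => by
    have := norm_meanIncrement_le hj (half_smul_subset hK h0)
      (fun s hs => add_mem_of_mem_half_smul hK hN hs) hp
    rwa [norm_smul, norm_inv, RCLike.norm_natCast] at this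
  have hQ := cubeAverage_mem hK h0 hc hx hN0 ((range N).erase n)
  have hshift := mul_mem_finiteProbabilities (pointMass_mem_finiteProbabilities (hx n)) hQ
  rw [← hK.add_smul (hc n) (Finset.sum_nonneg fun _ _ => hc _),
    Finset.add_sum_erase _ _ (Finset.mem_range.2 hnN)] at hshift
  rw [meanQuotient_add_basis j x hnN, two_mul]
  exact (norm_sub_le _ _).trans (add_le_add
    (hbound _ (finiteProbabilities_mono (hK.smul_subset_smul_of_le h0
      (Finset.sum_nonneg fun _ _ => hc _) (hsum _)) hshift))
    (hbound _ (cubeAverage_mem_half hK h0 hc hsum hx hN0 _)))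

lemma exists_smul_mem_of_mem_closure (hK : Convex ℝ K) (h0 : (0 : E) ∈ K)
    (hneg : ∀ f ∈ K, -f ∈ K) (hc : ∀ n, 0 ≤ c n) (hx : ∀ n, x n ∈ c n • K) {g : E}
    (hg : g ∈ AddSubgroup.closure (Set.range x)) : ∃ r : ℝ, 0 ≤ r ∧ g ∈ r • K := by
  induction hg using AddSubgroup.closure_induction with
  | mem g hg =>
    obtain ⟨n, rfl⟩ := hg
    exact ⟨c n, hc n, hx n⟩
  | zero => exact ⟨0, le_rfl, 0, h0, smul_zero _⟩
  | add a b _ _ ha hb =>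
    obtain ⟨r, hr, ha⟩ := ha
    obtain ⟨s, hs, hb⟩ := hb
    exact ⟨r + s, by positivity, hK.add_mem_smul hr hs ha hb⟩
  | neg a _ ha =>
    obtain ⟨r, hr, f, hf, rfl⟩ := ha
    exact ⟨r, hr, -f, hneg f hf, smul_neg _ _⟩

/-- The averaged difference quotients are asymptotically additive on the group generated by the
directions of the cube. -/
lemma tendsto_meanQuotient_add (hK : Convex ℝ K) (h0 : (0 : E) ∈ K)
    (hneg : ∀ f ∈ K, -f ∈ K)
    (hj : ∀ x ∈ K, ∀ y ∈ K, ‖j x - j y‖ = ‖x - y‖) (hc : ∀ n, 0 ≤ c n)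
    (hsum : ∀ F : Finset ℕ, ∑ n ∈ F, c n ≤ 1 / 2) (hx : ∀ n, x n ∈ c n • K) {h : E}
    (hh : h ∈ AddSubgroup.closure (Set.range x)) :
    ∀ g ∈ AddSubgroup.closure (Set.range x),
      Tendsto (fun N => meanQuotient j x N (g + h) - meanQuotient j x N g -
        meanQuotient j x N h) atTop (𝓝 0) := by
  induction hh using AddSubgroup.closure_induction with
  | mem h hh =>
    obtain ⟨n, rfl⟩ := hh
    exact fun g hg => tendsto_meanQuotient_add_basis hK h0 hj hc hsum hx
      (exists_smul_mem_of_mem_closure hK h0 hneg hc hx hg) n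
  | zero => simp [meanQuotient_zero]
  | add a b ha hb iha ihb =>
    intro g hg
    have := ((ihb (g + a) (add_mem hg ha)).add (iha g hg)).sub (ihb a ha)
    simp only [add_zero, sub_zero] at this
    refine this.congr fun N => ?_
    rw [← add_assoc]
    abel
  | neg a ha iha =>
    intro g hg
    have := (iha (-a) (neg_mem ha)).sub (iha (g + -a) (add_mem hg (neg_mem ha)))
    simp only [neg_add_cancel, neg_add_cancel_right, meanQuotient_zero, sub_zero] at this
    refine this.congr fun N => ?_
    abel

lemma exists_tendsto_meanQuotient [CompleteSpace Y] (hK : Convex ℝ K) (h0 : (0 : E) ∈ K)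
    (hneg : ∀ f ∈ K, -f ∈ K) (hcpt : IsCompact K)
    (hj : ∀ x ∈ K, ∀ y ∈ K, ‖j x - j y‖ = ‖x - y‖) (hc : ∀ n, 0 ≤ c n)
    (hsum : ∀ F : Finset ℕ, ∑ n ∈ F, c n ≤ 1 / 2) (hx : ∀ n, x n ∈ c n • K) (U : Ultrafilter ℕ)
    (hU : (U : Filter ℕ) ≤ atTop) {g : E} (hg : g ∈ AddSubgroup.closure (Set.range x)) :
    ∃ l, Tendsto (fun N => meanQuotient j x N g) U (𝓝 l) := by
  have hadd := fun {a b : E} (ha : a ∈ AddSubgroup.closure (Set.range x))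
    (hb : b ∈ AddSubgroup.closure (Set.range x)) =>
    (tendsto_meanQuotient_add hK h0 hneg hj hc hsum hx hb a ha).mono_left hU
  induction hg using AddSubgroup.closure_induction with
  | mem g hg =>
    obtain ⟨n, rfl⟩ := hg
    have hjK : IsCompact (j '' K) := by
      refine hcpt.image_of_continuousOn (LipschitzOnWith.continuousOn (K := 1) ?_)
      refine LipschitzOnWith.of_dist_le_mul fun a ha b hb => ?_
      simp [dist_eq_norm, hj a ha b hb]
    have hC : IsCompact (closure (convexHull ℝ (j '' K - j '' K))) :=
      (sub_eq_add_neg (j '' K) _ ▸ hjK.add hjK.neg).totallyBounded.convexHull.closure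
        |>.isCompact_of_isClosed isClosed_closure
    obtain ⟨l, -, hl⟩ := hC.ultrafilter_le_nhds (U.map fun N => meanQuotient j x N (x n))
      (le_principal_iff.2 (by
        filter_upwards [hU (eventually_meanQuotient_basis_mem hK h0 hc hsum hx n)] with N hN
        exact subset_closure hN))
    exact ⟨l, hl⟩
  | zero => exact ⟨0, by simp [meanQuotient_zero]⟩
  | add a b ha hb iha ihb =>
    obtain ⟨l, hl⟩ := iha
    obtain ⟨m, hm⟩ := ihb
    refine ⟨0 + l + m, (((hadd ha hb).add hl).add hm).congr fun N => ?_⟩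
    abel
  | neg a ha iha =>
    obtain ⟨l, hl⟩ := iha
    refine ⟨-(0 + l), ((hadd (neg_mem ha) ha).add hl).neg.congr fun N => ?_⟩
    rw [neg_add_cancel, meanQuotient_zero]
    abel

lemma exists_addMonoidHom_norm_eq [CompleteSpace Y] (hK : Convex ℝ K) (h0 : (0 : E) ∈ K)
    (hneg : ∀ f ∈ K, -f ∈ K) (hcpt : IsCompact K)
    (hj : ∀ x ∈ K, ∀ y ∈ K, ‖j x - j y‖ = ‖x - y‖)
    (hL : ∀ f : E, ∃ (e : E →ₗ[ℝ] ℝ) (L : Y →L[ℝ] ℝ), ‖L‖ ≤ 1 ∧ |e f| = ‖f‖ ∧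
      ∀ k ∈ K, L (j k) = e k)
    (hc : ∀ n, 0 ≤ c n)
    (hsum : ∀ F : Finset ℕ, ∑ n ∈ F, c n ≤ 1 / 2) (hx : ∀ n, x n ∈ c n • K) :
    ∃ T : AddSubgroup.closure (Set.range x) →+ Y, ∀ g, ‖T g‖ = ‖g‖ := by
  have hU : (hyperfilter ℕ : Filter ℕ) ≤ atTop := Nat.hyperfilter_le_atTop
  choose T hT using fun g : AddSubgroup.closure (Set.range x) =>
    exists_tendsto_meanQuotient hK h0 hneg hcpt hj hc hsum hx (hyperfilter ℕ) hU g.2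
  refine ⟨AddMonoidHom.mk' T fun a b => ?_, fun g => ?_⟩
  · have h1 := ((hT (a + b)).sub (hT a)).sub (hT b)
    have h2 := (tendsto_meanQuotient_add hK h0 hneg hj hc hsum hx b.2 a a.2).mono_left hU
    have h3 := tendsto_nhds_unique h1 h2
    rwa [sub_sub, sub_eq_zero] at h3
  · have hg := exists_smul_mem_of_mem_closure hK h0 hneg hc hx g.2
    refine le_antisymm (le_of_tendsto (hT g).norm
      (hU (eventually_norm_meanQuotient_le hK h0 hj hc hsum hx hg))) ?_
    obtain ⟨e, L, hL1, heg, hLe⟩ := hL g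
    have hlim : L (T g) = e g := tendsto_nhds_unique ((L.continuous.tendsto _).comp (hT g))
      (tendsto_const_nhds.congr' (by
        filter_upwards [hU (eventually_map_meanQuotient_eq hK h0 hLe hc hsum hx hg)] with N hN
        exact hN.symm))
    calc ‖g‖ = ‖L (T g)‖ := by rw [hlim, Real.norm_eq_abs, heg]; rfl
      _ ≤ ‖T g‖ := by simpa using L.le_of_opNorm_le hL1 (T g)

end Linearization

/-- A norm-preserving additive map defined on a dense subgroup extends to a linear isometry. -/
lemma AddSubgroup.exists_linearIsometry_of_dense {E Y : Type*} [NormedAddCommGroup E]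
    [NormedSpace ℝ E] [NormedAddCommGroup Y] [NormedSpace ℝ Y] [CompleteSpace Y]
    {G : AddSubgroup E} (hG : Dense (G : Set E)) (T : G →+ Y) (hT : ∀ g, ‖T g‖ = ‖g‖) :
    Nonempty (E →ₗᵢ[ℝ] Y) := by
  have hiso : Isometry T := AddMonoidHomClass.isometry_of_norm T hT
  have hcont : Continuous (hG.extend T) :=
    (hG.uniformContinuous_extend hiso.uniformContinuous).continuous
  have hext : ∀ g : G, hG.extend T g = T g := hG.extend_of_ind hiso.uniformContinuous
  have hadd : ∀ a b, hG.extend T (a + b) = hG.extend T a + hG.extend T b := by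
    refine isClosed_property2 hG.denseRange_val
      (isClosed_eq (by fun_prop) (by fun_prop)) fun a b => ?_
    rw [hext, hext, ← map_add, ← hext, AddSubgroup.coe_add]
  have hnorm : ∀ a, ‖hG.extend T a‖ = ‖a‖ := by
    refine isClosed_property hG.denseRange_val (isClosed_eq (by fun_prop) (by fun_prop)) fun a => ?_
    rw [hext, hT]
    rfl
  exact ⟨⟨((AddMonoidHom.mk' _ hadd).toRealLinearMap hcont : E →L[ℝ] Y).toLinearMap, hnorm⟩⟩

/-- If a compact convex symmetric set `K` with dense linear span embeds isometrically into a Banach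
space `Y` in such a way that enough functionals on `K` are traces of functionals on `Y`, then the
ambient space of `K` embeds linearly isometrically into `Y`. -/
theorem exists_linearIsometry_of_isometry_on {E Y : Type*} [NormedAddCommGroup E]
    [NormedSpace ℝ E] [TopologicalSpace.SeparableSpace E] [NormedAddCommGroup Y] [NormedSpace ℝ Y]
    [CompleteSpace Y] {K : Set E} {j : E → Y} (hK : Convex ℝ K) (h0 : (0 : E) ∈ K)
    (hneg : ∀ f ∈ K, -f ∈ K) (hcpt : IsCompact K)
    (hdense : Dense {f : E | ∃ r : ℝ, 0 ≤ r ∧ f ∈ r • K})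
    (hj : ∀ x ∈ K, ∀ y ∈ K, ‖j x - j y‖ = ‖x - y‖)
    (hL : ∀ f : E, ∃ (e : E →ₗ[ℝ] ℝ) (L : Y →L[ℝ] ℝ), ‖L‖ ≤ 1 ∧ |e f| = ‖f‖ ∧
      ∀ k ∈ K, L (j k) = e k) : Nonempty (E →ₗᵢ[ℝ] Y) := by
  obtain ⟨D, hDsub, hDc, hD⟩ := hdense.exists_countable_dense_subset
  obtain ⟨d, rfl⟩ := hDc.exists_eq_range hD.nonempty
  choose r hr hd using fun n => hDsub (mem_range_self n)
  choose M hM using fun n => exists_nat_ge (r n * 2 ^ (n + 2))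
  have hpos : ∀ n, (0 : ℝ) < (M n : ℝ) + 1 := fun n => by positivity
  have hx : ∀ n, ((M n + 1 : ℕ) : ℝ)⁻¹ • d n ∈ ((1 / 2 : ℝ) ^ (n + 2)) • K := fun n => by
    refine hK.smul_subset_smul_of_le h0 (a := ((M n + 1 : ℕ) : ℝ)⁻¹ * r n)
      (mul_nonneg (by positivity) (hr n)) ?_ ?_
    · have := hM n
      push_cast
      rw [inv_mul_le_iff₀ (hpos n), one_div, inv_pow, ← div_eq_mul_inv, le_div_iff₀ (by positivity)]
      linarith
    · rw [mul_smul]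
      exact Set.smul_mem_smul_set (hd n)
  have hsum : ∀ F : Finset ℕ, ∑ n ∈ F, (1 / 2 : ℝ) ^ (n + 2) ≤ 1 / 2 := fun F => by
    have hs : HasSum (fun n : ℕ => (1 / 2 : ℝ) ^ (n + 2)) (2 * (1 / 2) ^ 2) := by
      simpa only [pow_add] using hasSum_geometric_two.mul_right ((1 / 2 : ℝ) ^ 2)
    exact (sum_le_hasSum F (fun _ _ => by positivity) hs).trans (by norm_num)
  obtain ⟨T, hT⟩ := exists_addMonoidHom_norm_eq hK h0 hneg hcpt hj hL
    (fun n => by positivity) hsum hx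
  refine AddSubgroup.exists_linearIsometry_of_dense (hD.mono ?_) T hT
  rintro _ ⟨n, rfl⟩
  have := nsmul_mem (AddSubgroup.subset_closure
    (mem_range_self (f := fun n => ((M n + 1 : ℕ) : ℝ)⁻¹ • d n) n)) (M n + 1)
  rwa [← Nat.cast_smul_eq_nsmul ℝ, smul_inv_smul₀ (by positivity)] at this

section McShane

variable {C : Set ℝ} [CompactSpace C]

lemma bddBelow_range_mcShane (f : C(C, ℝ)) (t : ℝ) :
    BddBelow (Set.range fun c : C => f c + 1 / 4 * |t - c|) := by
  refine ⟨-‖f‖, ?_⟩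
  rintro _ ⟨c, rfl⟩
  have h1 := (abs_le.1 (f.norm_coe_le_norm c)).1
  have h2 := abs_nonneg (t - c)
  dsimp only
  linarith

lemma iInf_mcShane_le (f : C(C, ℝ)) (t : ℝ) (c : C) :
    ⨅ c : C, (f c + 1 / 4 * |t - c|) ≤ f c + 1 / 4 * |t - c| :=
  ciInf_le (bddBelow_range_mcShane f t) c

variable [Nonempty C]

lemma iInf_mcShane_sub_le (f : C(C, ℝ)) (s t : ℝ) :
    (⨅ c : C, (f c + 1 / 4 * |s - c|)) - ⨅ c : C, (f c + 1 / 4 * |t - c|) ≤ 1 / 4 * |s - t| := by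
  rw [sub_le_comm]
  refine le_ciInf fun c => ?_
  have h1 := iInf_mcShane_le f s c
  have h2 := abs_sub_le s t c
  linarith

lemma abs_iInf_mcShane_sub_le (f : C(C, ℝ)) (s t : ℝ) :
    |(⨅ c : C, (f c + 1 / 4 * |s - c|)) - ⨅ c : C, (f c + 1 / 4 * |t - c|)| ≤
      1 / 4 * |s - t| := by
  refine abs_le.2 ⟨?_, iInf_mcShane_sub_le f s t⟩
  have := iInf_mcShane_sub_le f t s
  rw [abs_sub_comm t s] at this
  linarith

/-- The McShane extension of `f` to the unit interval, with Lipschitz constant `1/4`. -/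
noncomputable def mcShane (f : C(C, ℝ)) : C(Set.Icc (0 : ℝ) 1, ℝ) where
  toFun t := ⨅ c : C, (f c + 1 / 4 * |(t : ℝ) - c|)
  continuous_toFun := (LipschitzWith.of_dist_le_mul (K := 1 / 4) fun s t => by
    simpa [Real.dist_eq, Subtype.dist_eq] using abs_iInf_mcShane_sub_le f s t).continuous

lemma mcShane_le (f : C(C, ℝ)) (t : Set.Icc (0 : ℝ) 1) (c : C) :
    mcShane f t ≤ f c + 1 / 4 * |(t : ℝ) - c| := iInf_mcShane_le f t c

lemma abs_mcShane_sub_le (f : C(C, ℝ)) (s t : Set.Icc (0 : ℝ) 1) :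
    |mcShane f s - mcShane f t| ≤ 1 / 4 * |(s : ℝ) - t| := abs_iInf_mcShane_sub_le f s t

lemma mcShane_sub_le (f g : C(C, ℝ)) (t : Set.Icc (0 : ℝ) 1) :
    mcShane f t - mcShane g t ≤ ‖f - g‖ := by
  rw [sub_le_comm]
  refine le_ciInf fun c => ?_
  have h1 := mcShane_le f t c
  have h2 := (abs_le.1 ((f - g).norm_coe_le_norm c)).2
  rw [ContinuousMap.sub_apply] at h2
  linarith

lemma mcShane_eq {f : C(C, ℝ)} (hf : ∀ s t : C, |f s - f t| ≤ 1 / 4 * |(s : ℝ) - t|)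
    (t : Set.Icc (0 : ℝ) 1) (ht : (t : ℝ) ∈ C) : mcShane f t = f ⟨t, ht⟩ := by
  refine le_antisymm (by simpa using mcShane_le f t ⟨t, ht⟩) (le_ciInf fun c => ?_)
  have := (abs_le.1 (hf ⟨t, ht⟩ c)).2
  linarith

/-- The functions on `C` bounded by `1/4` with Lipschitz constant `1/4`. -/
def smallLipschitz (C : Set ℝ) : Set C(C, ℝ) :=
  {f | (∀ s, |f s| ≤ 1 / 4) ∧ ∀ s t : C, |f s - f t| ≤ 1 / 4 * |(s : ℝ) - t|}

lemma abs_mcShane_le (hC : C ⊆ Set.Icc 0 1) {f : C(C, ℝ)} (hf : f ∈ smallLipschitz C)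
    (t : Set.Icc (0 : ℝ) 1) : |mcShane f t| ≤ 1 / 2 := by
  obtain ⟨c⟩ := ‹Nonempty C›
  have h1 := abs_mcShane_sub_le f t ⟨c, hC c.2⟩
  rw [mcShane_eq hf.2 ⟨c, hC c.2⟩ c.2] at h1
  have h2 := abs_le.1 (hf.1 c)
  have h3 : |(t : ℝ) - c| ≤ 1 := abs_sub_le_of_le_of_le t.2.1 t.2.2 (hC c.2).1 (hC c.2).2 |>.trans
    (by norm_num)
  have h4 := abs_le.1 h1
  simp only [Subtype.coe_eta] at h4
  exact abs_le.2 ⟨by linarith, by linarith⟩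

lemma norm_mcShane_sub (hC : C ⊆ Set.Icc 0 1) {f g : C(C, ℝ)} (hf : f ∈ smallLipschitz C)
    (hg : g ∈ smallLipschitz C) : ‖mcShane f - mcShane g‖ = ‖f - g‖ := by
  refine le_antisymm ((ContinuousMap.norm_le _ (norm_nonneg _)).2 fun t => ?_)
    ((ContinuousMap.norm_le _ (norm_nonneg _)).2 fun c => ?_)
  · refine abs_le.2 ⟨?_, mcShane_sub_le f g t⟩
    have := mcShane_sub_le g f t
    rw [norm_sub_rev] at this
    rw [ContinuousMap.sub_apply]
    linarith
  · have := (mcShane f - mcShane g).norm_coe_le_norm ⟨c, hC c.2⟩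
    rwa [ContinuousMap.sub_apply, mcShane_eq hf.2 ⟨c, hC c.2⟩ c.2,
      mcShane_eq hg.2 ⟨c, hC c.2⟩ c.2] at this

lemma mcShane_mem (hC : C ⊆ Set.Icc 0 1) {f : C(C, ℝ)} (hf : f ∈ smallLipschitz C) :
    mcShane f ∈ {f : C(Set.Icc (0 : ℝ) 1, ℝ) | ‖f‖ ≤ 1 ∧ LipschitzWith 1 f} := by
  refine ⟨(ContinuousMap.norm_le _ zero_le_one).2 fun t =>
    (abs_mcShane_le hC hf t).trans (by norm_num), LipschitzWith.of_dist_le_mul fun s t => ?_⟩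
  have := abs_mcShane_sub_le f s t
  have h := abs_nonneg ((s : ℝ) - t)
  rw [Real.dist_eq, Subtype.dist_eq, Real.dist_eq, NNReal.coe_one]
  linarith

end McShane

section SmallLipschitz

variable {C : Set ℝ}

lemma convex_smallLipschitz : Convex ℝ (smallLipschitz C) := by
  intro f hf g hg a b ha hb hab
  have key : ∀ {u v w : ℝ}, |u| ≤ w → |v| ≤ w → |a * u + b * v| ≤ w := fun {u v w} hu hv =>
    (convex_Icc (-w) w (abs_le.1 hu) (abs_le.1 hv) ha hb hab : _) |> abs_le.2
  refine ⟨fun s => key (hf.1 s) (hg.1 s), fun s t => ?_⟩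
  convert key (hf.2 s t) (hg.2 s t) using 2
  simp only [ContinuousMap.add_apply, ContinuousMap.smul_apply, smul_eq_mul]
  ring

lemma zero_mem_smallLipschitz : (0 : C(C, ℝ)) ∈ smallLipschitz C :=
  ⟨fun s => by simp, fun s t => by simp⟩

lemma neg_mem_smallLipschitz {f : C(C, ℝ)} (hf : f ∈ smallLipschitz C) :
    -f ∈ smallLipschitz C := by
  refine ⟨fun s => by simpa using hf.1 s, fun s t => ?_⟩
  have := hf.2 t s
  rw [abs_sub_comm (t : ℝ)] at this
  simpa [neg_add_eq_sub] using this

lemma isCompact_smallLipschitz : IsCompact (smallLipschitz C) := by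
  refine ArzelaAscoli.isCompact_of_equicontinuous _ ?_ ?_
  · have himage : ContinuousMap.toFun '' smallLipschitz C =
        {f : C → ℝ | (∀ s, f s ∈ Set.Icc (-(1 / 4)) (1 / 4 : ℝ)) ∧
          ∀ s t : C, |f s - f t| ≤ 1 / 4 * |(s : ℝ) - t|} := by
      ext f
      constructor
      · rintro ⟨f, hf, rfl⟩
        exact ⟨fun s => abs_le.1 (hf.1 s), hf.2⟩
      · intro hf
        have hcont : Continuous f := (LipschitzWith.of_dist_le_mul (K := 1 / 4) fun s t => by
          simpa [Real.dist_eq, Subtype.dist_eq] using hf.2 s t).continuous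
        exact ⟨⟨f, hcont⟩, ⟨fun s => abs_le.2 (hf.1 s), hf.2⟩, rfl⟩
    rw [himage]
    refine IsCompact.of_isClosed_subset
      (isCompact_univ_pi fun _ : C => isCompact_Icc (a := -(1 / 4 : ℝ)) (b := 1 / 4)) ?_
      (fun f hf s _ => hf.1 s)
    simp only [Set.ofPred_and, Set.ofPred_forall]
    refine (isClosed_iInter fun s => isClosed_Icc.preimage (continuous_apply s)).inter
      (isClosed_iInter fun s => isClosed_iInter fun t => isClosed_le (by fun_prop) (by fun_prop))
  · refine (LipschitzWith.uniformEquicontinuous _ (1 / 4) fun f =>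
      LipschitzWith.of_dist_le_mul fun s t => ?_).equicontinuous
    simpa [Real.dist_eq, Subtype.dist_eq] using f.2.2 s t

lemma dense_smul_smallLipschitz [CompactSpace C] (hC : C ⊆ Set.Icc 0 1) :
    Dense {f : C(C, ℝ) | ∃ r : ℝ, 0 ≤ r ∧ f ∈ r • smallLipschitz C} := by
  have hpoly : Dense (polynomialFunctions C : Set C(C, ℝ)) := by
    have := polynomialFunctions.topologicalClosure C
    rw [dense_iff_closure_eq, ← Subalgebra.topologicalClosure_coe, this, Algebra.coe_top]
  refine hpoly.mono ?_
  rintro f hf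
  obtain ⟨p, -, rfl⟩ := hf
  obtain ⟨B, hB⟩ := (isCompact_Icc (a := (0 : ℝ)) (b := 1)).exists_bound_of_continuousOn
    (f := fun x => p.derivative.eval x) p.derivative.continuous.continuousOn
  set f : C(C, ℝ) := Polynomial.toContinuousMapOnAlgHom C p
  have hB0 : 0 ≤ B := (norm_nonneg _).trans (hB 0 (by simp))
  have hlip : ∀ s t : C, |f s - f t| ≤ B * |(s : ℝ) - t| := fun s t =>
    (convex_Icc (0 : ℝ) 1).norm_image_sub_le_of_norm_deriv_le (f := fun x => p.eval x)
      (fun x _ => p.differentiable x) (fun x hx => by simpa using hB x hx) (hC t.2) (hC s.2)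
  have hpos : 0 < 4 * (‖f‖ + B) + 1 := by positivity
  refine ⟨4 * (‖f‖ + B) + 1, hpos.le, (Set.mem_smul_set_iff_inv_smul_mem₀ hpos.ne' _ _).2
    ⟨fun s => ?_, fun s t => ?_⟩⟩
  · have h := f.norm_coe_le_norm s
    rw [Real.norm_eq_abs] at h
    rw [ContinuousMap.smul_apply, smul_eq_mul, abs_mul, abs_inv, abs_of_pos hpos,
      inv_mul_le_iff₀ hpos]
    exact h.trans (by linarith)
  · rw [ContinuousMap.smul_apply, ContinuousMap.smul_apply, smul_eq_mul, smul_eq_mul, ← mul_sub,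
      abs_mul, abs_inv, abs_of_pos hpos, inv_mul_le_iff₀ hpos]
    have := norm_nonneg f
    calc _ ≤ B * |(s : ℝ) - t| := hlip s t
      _ ≤ ((4 * (‖f‖ + B) + 1) * (1 / 4)) * |(s : ℝ) - t| := by gcongr; linarith
      _ = _ := by ring

end SmallLipschitz

section Evaluation

/-- The tent function with peak value `1` at `t`. -/
noncomputable def tent (t : Set.Icc (0 : ℝ) 1) : C(Set.Icc (0 : ℝ) 1, ℝ) where
  toFun s := 1 - |(s : ℝ) - t|

lemma tent_apply (s t : Set.Icc (0 : ℝ) 1) : tent t s = 1 - |(s : ℝ) - t| := rfl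

lemma tent_nonneg (s t : Set.Icc (0 : ℝ) 1) : 0 ≤ tent t s := by
  have := abs_sub_le_of_le_of_le s.2.1 s.2.2 t.2.1 t.2.2
  rw [tent_apply]
  linarith

lemma abs_tent_sub_le (t r s : Set.Icc (0 : ℝ) 1) :
    |tent t r - tent t s| ≤ |(r : ℝ) - s| := by
  have := abs_abs_sub_abs_le ((s : ℝ) - t) (r - t)
  rw [sub_sub_sub_cancel_right, abs_sub_comm (s : ℝ) r] at this
  simpa [tent_apply] using this

lemma abs_tent_le (s t : Set.Icc (0 : ℝ) 1) : |tent t s| ≤ 1 := by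
  rw [abs_of_nonneg (tent_nonneg s t), tent_apply]
  linarith [abs_nonneg ((s : ℝ) - t)]

lemma tent_mem (t : Set.Icc (0 : ℝ) 1) :
    tent t ∈ {f : C(Set.Icc (0 : ℝ) 1, ℝ) | ‖f‖ ≤ 1 ∧ LipschitzWith 1 f} :=
  ⟨(ContinuousMap.norm_le _ zero_le_one).2 fun s => abs_tent_le s t,
    LipschitzWith.of_dist_le_mul fun r s => by
      simpa [Real.dist_eq, Subtype.dist_eq] using abs_tent_sub_le t r s⟩

lemma neg_tent_mem (t : Set.Icc (0 : ℝ) 1) :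
    -tent t ∈ {f : C(Set.Icc (0 : ℝ) 1, ℝ) | ‖f‖ ≤ 1 ∧ LipschitzWith 1 f} :=
  ⟨by simpa using (tent_mem t).1, by simpa using (tent_mem t).2.neg⟩

lemma norm_tent_sub_le {t : Set.Icc (0 : ℝ) 1} {f : C(Set.Icc (0 : ℝ) 1, ℝ)}
    (hf : LipschitzWith 1 f) (hb : ∀ s, |f s| ≤ 1 / 2) : ‖tent t - f‖ ≤ 1 - f t := by
  have ht := abs_le.1 (hb t)
  refine (ContinuousMap.norm_le _ (by linarith)).2 fun s => ?_
  have h1 := hf.dist_le_mul s t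
  rw [Real.dist_eq, Subtype.dist_eq, Real.dist_eq, NNReal.coe_one, one_mul] at h1
  have h2 := abs_le.1 (hb s)
  have h3 := tent_nonneg s t
  rw [ContinuousMap.sub_apply, Real.norm_eq_abs, abs_le]
  constructor
  · linarith
  · rw [tent_apply]
    linarith [(abs_le.1 h1).1]

/-- Evaluation at a point, on increments of half-bounded functions, is the trace of a functional
of norm at most one on any Banach space containing an isometric copy of `K₀`. -/
lemma exists_functional_eq_eval {Y : Type*} [NormedAddCommGroup Y] [NormedSpace ℝ Y]
    {j : {f : C(Set.Icc (0 : ℝ) 1, ℝ) | ‖f‖ ≤ 1 ∧ LipschitzWith 1 f} → Y} (hj : Isometry j)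
    (t : Set.Icc (0 : ℝ) 1) : ∃ L : Y →L[ℝ] ℝ, ‖L‖ ≤ 1 ∧
      ∀ f g : {f : C(Set.Icc (0 : ℝ) 1, ℝ) | ‖f‖ ≤ 1 ∧ LipschitzWith 1 f},
        (∀ s, |f.1 s| ≤ 1 / 2) → (∀ s, |g.1 s| ≤ 1 / 2) →
          L (j f - j g) = f.1 t - g.1 t := by
  have hnorm : ∀ f g, ‖j f - j g‖ = ‖f.1 - g.1‖ := fun f g => by
    rw [← dist_eq_norm, hj.dist_eq, Subtype.dist_eq, dist_eq_norm]
  set u : {f : C(Set.Icc (0 : ℝ) 1, ℝ) | ‖f‖ ≤ 1 ∧ LipschitzWith 1 f} := ⟨tent t, tent_mem t⟩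
  set v : {f : C(Set.Icc (0 : ℝ) 1, ℝ) | ‖f‖ ≤ 1 ∧ LipschitzWith 1 f} := ⟨-tent t, neg_tent_mem t⟩
  obtain ⟨L, hL, hLuv⟩ := exists_dual_vector'' ℝ (j u - j v)
  have hle : ∀ f g, L (j f) - L (j g) ≤ ‖f.1 - g.1‖ := fun f g => by
    rw [← map_sub, ← hnorm]
    exact (le_abs_self _).trans (by simpa using L.le_of_opNorm_le hL (j f - j g))
  have huv : 2 ≤ L (j u) - L (j v) := by
    rw [← map_sub, hLuv, hnorm]
    have := (u.1 - v.1).norm_coe_le_norm t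
    refine le_trans (le_of_eq ?_) this
    simp only [u, v, sub_neg_eq_add, ContinuousMap.add_apply, tent_apply]
    norm_num
  have key : ∀ f : {f : C(Set.Icc (0 : ℝ) 1, ℝ) | ‖f‖ ≤ 1 ∧ LipschitzWith 1 f},
      (∀ s, |f.1 s| ≤ 1 / 2) → L (j f) = L (j u) - 1 + f.1 t := fun f hf => by
    have h1 := (hle u f).trans (norm_tent_sub_le f.2.2 hf)
    have h2 : L (j f) - L (j v) ≤ 1 + f.1 t := by
      refine (hle f v).trans ?_
      have := norm_tent_sub_le (t := t) (f := -f.1) (by simpa using f.2.2.neg) (by simpa using hf)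
      simpa [v, add_comm] using this
    linarith
  refine ⟨L, hL, fun f g hf hg => ?_⟩
  rw [map_sub, key f hf, key g hg]
  ring

end Evaluation

/-- If `K₀` embeds isometrically into a Banach space `Y`, then the continuous functions on any
nonempty compact subset of the unit interval embed linearly isometrically into `Y`. -/
theorem exists_linearIsometry_continuousMap {Y : Type*} [NormedAddCommGroup Y] [NormedSpace ℝ Y]
    [CompleteSpace Y] {C : Set ℝ} [CompactSpace C] [Nonempty C] (hC : C ⊆ Set.Icc 0 1)
    {j : {f : C(Set.Icc (0 : ℝ) 1, ℝ) | ‖f‖ ≤ 1 ∧ LipschitzWith 1 f} → Y} (hj : Isometry j) :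
    Nonempty (C(C, ℝ) →ₗᵢ[ℝ] Y) := by
  classical
  let E : C(C, ℝ) → {f : C(Set.Icc (0 : ℝ) 1, ℝ) | ‖f‖ ≤ 1 ∧ LipschitzWith 1 f} := fun f =>
    if hf : f ∈ smallLipschitz C then ⟨mcShane f, mcShane_mem hC hf⟩
    else ⟨mcShane 0, mcShane_mem hC zero_mem_smallLipschitz⟩
  have hE : ∀ f ∈ smallLipschitz C, (E f).1 = mcShane f := fun f hf => by simp only [E, dif_pos hf]
  refine exists_linearIsometry_of_isometry_on (K := smallLipschitz C)
    (j := fun f => j (E f) - j (E 0)) convex_smallLipschitz zero_mem_smallLipschitz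
    (fun _ => neg_mem_smallLipschitz) isCompact_smallLipschitz (dense_smul_smallLipschitz hC)
    (fun f hf g hg => ?_) (fun f => ?_)
  · rw [sub_sub_sub_cancel_right, ← dist_eq_norm, hj.dist_eq, Subtype.dist_eq, dist_eq_norm,
      hE f hf, hE g hg, norm_mcShane_sub hC hf hg]
  · obtain ⟨c, -, hc⟩ := isCompact_univ.exists_isMaxOn univ_nonempty
      (f := fun c => ‖f c‖) (by fun_prop)
    obtain ⟨L, hL, hLe⟩ := exists_functional_eq_eval hj ⟨c, hC c.2⟩
    have hhalf : ∀ g ∈ smallLipschitz C, ∀ s, |(E g).1 s| ≤ 1 / 2 := fun g hg s => by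
      rw [hE g hg]
      exact abs_mcShane_le hC hg s
    refine ⟨(ContinuousMap.evalCLM ℝ c).toLinearMap, L, hL, ?_, fun g hg => ?_⟩
    · exact le_antisymm (f.norm_coe_le_norm c)
        ((ContinuousMap.norm_le _ (norm_nonneg (f c))).2 fun s => hc (mem_univ s))
    · rw [hLe _ _ (hhalf g hg) (hhalf 0 zero_mem_smallLipschitz), hE g hg,
        hE 0 zero_mem_smallLipschitz, mcShane_eq hg.2 ⟨c, hC c.2⟩ c.2,
        mcShane_eq zero_mem_smallLipschitz.2 ⟨c, hC c.2⟩ c.2]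
      simp

/-- Every separable Banach space embeds linearly isometrically into the continuous functions on the
Cantor set. -/
theorem exists_linearIsometry_cantorSet (X : Type*) [NormedAddCommGroup X] [NormedSpace ℝ X]
    [TopologicalSpace.SeparableSpace X] [CompactSpace cantorSet] :
    Nonempty (X →ₗᵢ[ℝ] C(cantorSet, ℝ)) := by
  let B : Set (WeakDual ℝ X) := WeakDual.toStrongDual ⁻¹' Metric.closedBall 0 1
  have hB : IsCompact B := WeakDual.isCompact_closedBall 0 1
  have : CompactSpace B := isCompact_iff_compactSpace.1 hB
  have : TopologicalSpace.MetrizableSpace B := WeakDual.metrizable_of_isCompact ℝ X B hB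
  let : MetricSpace B := TopologicalSpace.metrizableSpaceMetric B
  have : Nonempty B := ⟨⟨0, by simp [B]⟩⟩
  obtain ⟨φ, hφ, hsurj⟩ := exists_nat_bool_continuous_surjective_of_compact B
  let ψ : cantorSet → B := φ ∘ cantorSetHomeomorphNatToBool
  have hψ : Continuous ψ := hφ.comp cantorSetHomeomorphNatToBool.continuous
  have hψs : Function.Surjective ψ := hsurj.comp cantorSetHomeomorphNatToBool.surjective
  let T : X →ₗ[ℝ] C(cantorSet, ℝ) :=
    { toFun := fun x => ⟨fun c => (ψ c).1 x,
        (WeakDual.eval_continuous x).comp (continuous_subtype_val.comp hψ)⟩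
      map_add' := fun x y => by ext c; simp
      map_smul' := fun r x => by ext c; simp }
  refine ⟨⟨T, fun x => le_antisymm ((ContinuousMap.norm_le _ (norm_nonneg x)).2 fun c => ?_) ?_⟩⟩
  · have h1 : ‖WeakDual.toStrongDual (ψ c).1‖ ≤ 1 := mem_closedBall_zero_iff.1 (ψ c).2
    exact ((WeakDual.toStrongDual (ψ c).1).le_of_opNorm_le h1 x).trans_eq (one_mul _)
  · obtain ⟨L, hL, hLx⟩ := exists_dual_vector'' ℝ x
    obtain ⟨c, hc⟩ := hψs ⟨StrongDual.toWeakDual L, mem_closedBall_zero_iff.2 hL⟩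
    have h2 := (T x).norm_coe_le_norm c
    have h3 : T x c = ‖x‖ := by
      change (ψ c).1 x = ‖x‖
      rw [hc]
      exact hLx
    rwa [h3, norm_norm] at h2

/-- Let `K₀ = {f ∈ C([0,1]) : ‖f‖∞ ≤ 1 and f is 1-Lipschitz}`. If a real
Banach space `Y` contains an isometric copy of `K₀`, then every separable real Banach space
is linearly isometric to a subspace of `Y`. -/
theorem stmt5 (Y : Type*) [NormedAddCommGroup Y] [NormedSpace ℝ Y] [CompleteSpace Y]
    (h : ∃ j : {f : C(Set.Icc (0:ℝ) 1, ℝ) | ‖f‖ ≤ 1 ∧ LipschitzWith 1 f} → Y, Isometry j) :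
    ∀ (X : Type u) [NormedAddCommGroup X] [NormedSpace ℝ X] [CompleteSpace X]
      [TopologicalSpace.SeparableSpace X],
      Nonempty (X →ₗᵢ[ℝ] Y) := by
  intro X _ _ _ _
  obtain ⟨j, hj⟩ := h
  have : CompactSpace cantorSet := isCompact_iff_compactSpace.1 isCompact_cantorSet
  have : Nonempty cantorSet := ⟨⟨0, zero_mem_cantorSet⟩⟩
  obtain ⟨T⟩ := exists_linearIsometry_cantorSet X
  obtain ⟨S⟩ := exists_linearIsometry_continuousMap cantorSet_subset_unitInterval hj
  exact ⟨S.comp T⟩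
end

section
/- Let R and S be compact metric spaces and let B denote the closed unit ball of C(R). Suppose F : B → C(S) is a map satisfying (15/16)·‖f − g‖∞ ≤ ‖F(f) − F(g)‖∞ ≤ ‖f − g‖∞ for all f, g ∈ B. Then there exists a linear isometric embedding of C(R) into C(S). -/
/-- Weights of the averages extending functions from `A`: the weight of the point `a n` at `x` is
positive only if `a n` is an almost nearest point of `A` to `x`. -/
noncomputable def extensionWeight {S : Type*} [MetricSpace S] (A : Set S) (a : ℕ → A) (n : ℕ)
    (x : S) : ℝ :=
  (1 / 2) ^ n * min 1 (max 0 (2 * Metric.infDist x A - dist x (a n)))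

section Extension

variable {S : Type*} [MetricSpace S] {A : Set S} (a : ℕ → A)

lemma extensionWeight_nonneg (n : ℕ) (x : S) : 0 ≤ extensionWeight A a n x := by
  unfold extensionWeight
  positivity

lemma extensionWeight_le (n : ℕ) (x : S) : extensionWeight A a n x ≤ (1 / 2) ^ n :=
  mul_le_of_le_one_right (by positivity) (min_le_left _ _)

lemma continuous_extensionWeight (n : ℕ) : Continuous (extensionWeight A a n) := by
  unfold extensionWeight
  have := Metric.continuous_infDist_pt A
  fun_prop

lemma summable_extensionWeight (x : S) : Summable fun n => extensionWeight A a n x :=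
  Summable.of_nonneg_of_le (extensionWeight_nonneg a · x) (extensionWeight_le a · x)
    summable_geometric_two

lemma dist_lt_of_extensionWeight_ne_zero {n : ℕ} {x : S} (h : extensionWeight A a n x ≠ 0) :
    dist x (a n) < 2 * Metric.infDist x A := by
  by_contra! hle
  refine h ?_
  rw [extensionWeight, max_eq_left (by linarith)]
  simp

lemma tsum_extensionWeight_pos (ha : DenseRange a) (hA : IsClosed A) {x : S} (hx : x ∉ A) :
    0 < ∑' n, extensionWeight A a n x := by
  have hne : A.Nonempty := ⟨a 0, (a 0).2⟩
  have hpos : 0 < Metric.infDist x A := (hA.notMem_iff_infDist_pos hne).1 hx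
  obtain ⟨b, hb, hxb⟩ := (Metric.infDist_lt_iff hne).1
    (show Metric.infDist x A < 2 * Metric.infDist x A by linarith)
  have hopen : IsOpen {c : A | dist x c < 2 * Metric.infDist x A} :=
    isOpen_lt (by fun_prop) continuous_const
  obtain ⟨n, hn⟩ := ha.exists_mem_open hopen ⟨⟨b, hb⟩, hxb⟩
  refine (summable_extensionWeight a x).tsum_pos (extensionWeight_nonneg a · x) n ?_
  have : 0 < 2 * Metric.infDist x A - dist x (a n) := sub_pos.2 hn
  unfold extensionWeight
  have h2 : 0 < min 1 (max 0 (2 * Metric.infDist x A - dist x (a n))) :=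
    lt_min one_pos (lt_max_of_lt_right this)
  positivity

variable [CompactSpace A]

lemma summable_extensionWeight_mul (u : C(A, ℝ)) (x : S) :
    Summable fun n => extensionWeight A a n x * u (a n) := by
  refine Summable.of_norm_bounded ((summable_extensionWeight a x).mul_right ‖u‖) fun n => ?_
  rw [norm_mul, Real.norm_of_nonneg (extensionWeight_nonneg a n x)]
  exact mul_le_mul_of_nonneg_left (u.norm_coe_le_norm _) (extensionWeight_nonneg a n x)

open Classical in
/-- The extension of a function on `A` by weighted averages of its values. -/
noncomputable def weightedExtension (u : C(A, ℝ)) (x : S) : ℝ :=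
  if hx : x ∈ A then u ⟨x, hx⟩
  else (∑' n, extensionWeight A a n x * u (a n)) / ∑' n, extensionWeight A a n x

lemma abs_weightedExtension_sub_le (ha : DenseRange a) (hA : IsClosed A) (u : C(A, ℝ)) {x : S}
    (hx : x ∉ A) {c ε : ℝ} (h : ∀ b : A, dist x b < 2 * Metric.infDist x A → |u b - c| ≤ ε) :
    |weightedExtension a u x - c| ≤ ε := by
  have hpos := tsum_extensionWeight_pos a ha hA hx
  have hs := summable_extensionWeight a x
  rw [weightedExtension, dif_neg hx, div_sub' hpos.ne', abs_div, abs_of_pos hpos,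
    div_le_iff₀ hpos, ← hs.tsum_mul_right, ← hs.tsum_mul_left,
    ← (summable_extensionWeight_mul a u x).tsum_sub (hs.mul_right c), ← Real.norm_eq_abs]
  refine tsum_of_norm_bounded (hs.mul_left ε).hasSum fun n => ?_
  rw [← mul_sub, norm_mul, Real.norm_of_nonneg (extensionWeight_nonneg a n x), mul_comm ε]
  by_cases h0 : extensionWeight A a n x = 0
  · simp [h0]
  · exact mul_le_mul_of_nonneg_left (h _ (dist_lt_of_extensionWeight_ne_zero a h0))
      (extensionWeight_nonneg a n x)

lemma abs_weightedExtension_le (ha : DenseRange a) (hA : IsClosed A) (u : C(A, ℝ)) (x : S) :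
    |weightedExtension a u x| ≤ ‖u‖ := by
  by_cases hx : x ∈ A
  · rw [weightedExtension, dif_pos hx]
    exact u.norm_coe_le_norm _
  · have := abs_weightedExtension_sub_le a ha hA u hx (c := 0) (ε := ‖u‖)
      fun b _ => by simpa using u.norm_coe_le_norm b
    simpa using this

lemma continuous_weightedExtension (ha : DenseRange a) (hA : IsClosed A) (u : C(A, ℝ)) :
    Continuous (weightedExtension a u) := by
  refine continuous_iff_continuousAt.2 fun x => ?_
  by_cases hx : x ∈ A
  · refine Metric.continuousAt_iff.2 fun ε hε => ?_
    obtain ⟨δ, hδ, h⟩ := Metric.continuousAt_iff.1 (u.continuous.continuousAt (x := ⟨x, hx⟩))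
      (ε / 2) (half_pos hε)
    refine ⟨δ / 3, by positivity, fun {y} hy => ?_⟩
    have hux : weightedExtension a u x = u ⟨x, hx⟩ := dif_pos hx
    rw [hux]
    by_cases hyA : y ∈ A
    · rw [weightedExtension, dif_pos hyA]
      have := h (x := ⟨y, hyA⟩) (show dist y x < δ by linarith)
      linarith
    · refine lt_of_le_of_lt (abs_weightedExtension_sub_le a ha hA u hyA (ε := ε / 2)
        fun b hb => ?_) (half_lt_self hε)
      refine (h (x := b) (show dist (b : S) x < δ from ?_)).le
      have h1 := Metric.infDist_le_dist_of_mem (x := y) hx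
      have h2 := dist_triangle_left (b : S) x y
      linarith
  · have hN : Continuous fun x => ∑' n, extensionWeight A a n x * u (a n) := by
      refine continuous_tsum (fun n => (continuous_extensionWeight a n).mul_const _)
        (summable_geometric_two.mul_right ‖u‖) fun n y => ?_
      rw [norm_mul, Real.norm_of_nonneg (extensionWeight_nonneg a n y)]
      exact mul_le_mul (extensionWeight_le a n y) (u.norm_coe_le_norm _) (norm_nonneg _)
        (by positivity)
    have hW : Continuous fun x => ∑' n, extensionWeight A a n x := by
      refine continuous_tsum (continuous_extensionWeight a) summable_geometric_two fun n y => ?_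
      rw [Real.norm_of_nonneg (extensionWeight_nonneg a n y)]
      exact extensionWeight_le a n y
    refine (hN.continuousAt.div hW.continuousAt
      (tsum_extensionWeight_pos a ha hA hx).ne').congr ?_
    filter_upwards [hA.isOpen_compl.mem_nhds hx] with y hy
    rw [weightedExtension, dif_neg hy]
    rfl

end Extension

/-- A linear extension operator of norm at most one from a closed subset. -/
lemma exists_linear_extension {S : Type*} [MetricSpace S] [CompactSpace S] {A : Set S}
    [CompactSpace A] (hA : IsClosed A) (hne : A.Nonempty) :
    ∃ E : C(A, ℝ) →ₗ[ℝ] C(S, ℝ), (∀ u (x : A), E u x = u x) ∧ ∀ u x, |E u x| ≤ ‖u‖ := by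
  have : Nonempty A := hne.to_subtype
  set a : ℕ → A := TopologicalSpace.denseSeq A
  have ha : DenseRange a := TopologicalSpace.denseRange_denseSeq A
  refine ⟨{
      toFun := fun u => ⟨weightedExtension a u, continuous_weightedExtension a ha hA u⟩
      map_add' := fun u v => ?_
      map_smul' := fun c u => ?_ }, fun u x => dif_pos x.2,
    fun u x => abs_weightedExtension_le a ha hA u x⟩
  · ext x
    by_cases hx : x ∈ A
    · simp [weightedExtension, hx]
    · simp [weightedExtension, hx, mul_add, add_div, (summable_extensionWeight_mul a u x).tsum_add
        (summable_extensionWeight_mul a v x)]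
  · ext x
    by_cases hx : x ∈ A
    · simp [weightedExtension, hx]
    · simp [weightedExtension, hx, mul_left_comm _ c, tsum_mul_left, mul_div_assoc]

/-- A closed relation which is the graph of a map from a subset of `S` onto `R` yields
a linear isometric embedding of `C(R, ℝ)` into `C(S, ℝ)`. -/
lemma nonempty_linearIsometry_of_isClosed_rel {R S : Type*} [MetricSpace R] [CompactSpace R]
    [MetricSpace S] [CompactSpace S] {Γ : Set (R × S)} (hΓ : IsClosed Γ)
    (hsurj : ∀ r, ∃ s, (r, s) ∈ Γ) (hinj : ∀ r r' s, (r, s) ∈ Γ → (r', s) ∈ Γ → r = r') :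
    Nonempty (C(R, ℝ) →ₗᵢ[ℝ] C(S, ℝ)) := by
  rcases isEmpty_or_nonempty R with hR | ⟨⟨r₀⟩⟩
  · exact ⟨⟨0, fun f => by simp [Subsingleton.elim f 0]⟩⟩
  set A : Set S := Prod.snd '' Γ
  have hAc : IsCompact A := hΓ.isCompact.image continuous_snd
  have : CompactSpace A := isCompact_iff_compactSpace.1 hAc
  have hex : ∀ x : A, ∃ r, (r, (x : S)) ∈ Γ := by
    rintro ⟨_, ⟨r, s⟩, h, rfl⟩
    exact ⟨r, h⟩
  choose φ hφ using hex
  have hφc : Continuous φ := by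
    refine continuous_iff_isClosed.2 fun C hC => ?_
    have : φ ⁻¹' C = Prod.snd '' {p : R × A | (p.1, (p.2 : S)) ∈ Γ ∧ p.1 ∈ C} := by
      ext x
      refine ⟨fun hx => ⟨(φ x, x), ⟨hφ x, hx⟩, rfl⟩, ?_⟩
      rintro ⟨⟨r, y⟩, ⟨hr, hrC⟩, rfl⟩
      exact Set.mem_preimage.2 (hinj _ _ _ hr (hφ y) ▸ hrC)
    rw [this]
    exact isClosedMap_snd_of_compactSpace _
      ((hΓ.preimage (by fun_prop : Continuous fun p : R × A => (p.1, (p.2 : S)))).inter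
        (hC.preimage continuous_fst))
  have hφs : Function.Surjective φ := fun r => by
    obtain ⟨s, hs⟩ := hsurj r
    exact ⟨⟨s, (r, s), hs, rfl⟩, hinj _ _ _ (hφ _) hs⟩
  obtain ⟨s₀, hs₀⟩ := hsurj r₀
  obtain ⟨E, hE, hEn⟩ := exists_linear_extension hAc.isClosed ⟨s₀, (r₀, s₀), hs₀, rfl⟩
  let T : C(R, ℝ) →ₗ[ℝ] C(A, ℝ) :=
    { toFun := fun f => f.comp ⟨φ, hφc⟩, map_add' := fun _ _ => rfl, map_smul' := fun _ _ => rfl }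
  refine ⟨⟨E ∘ₗ T, fun f => le_antisymm ?_ ?_⟩⟩
  · refine (ContinuousMap.norm_le _ (norm_nonneg _)).2 fun x => (hEn _ x).trans ?_
    exact (ContinuousMap.norm_le _ (norm_nonneg _)).2 fun y => f.norm_coe_le_norm _
  · refine (ContinuousMap.norm_le _ (norm_nonneg _)).2 fun r => ?_
    obtain ⟨x, rfl⟩ := hφs r
    have := (E (T f)).norm_coe_le_norm x
    rwa [hE] at this

/-- The functions of norm `1 / 2` attaining their norm at `r`. -/
def peakFunctions {R : Type*} [TopologicalSpace R] [CompactSpace R] (r : R) : Set C(R, ℝ) :=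
  {g | (∀ x, |g x| ≤ 1 / 2) ∧ g r = 1 / 2}

/-- The pairs `(r, s)` such that the odd part of `G`, multiplied by `σ`, is large at `s` on all
functions peaking at `r`. -/
def peakRel {R S : Type*} [TopologicalSpace R] [CompactSpace R] [TopologicalSpace S]
    (G : C(R, ℝ) → C(S, ℝ)) (σ : ℝ) : Set (R × S) :=
  {p | ∀ g ∈ peakFunctions p.1, 7 / 8 ≤ σ * (G g p.2 - G (-g) p.2)}

section Peak

variable {R S : Type*} [MetricSpace R] [CompactSpace R]

lemma norm_le_one_of_abs_le_half {f : C(R, ℝ)} (hf : ∀ x, |f x| ≤ 1 / 2) : ‖f‖ ≤ 1 :=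
  (ContinuousMap.norm_le _ zero_le_one).2 fun x => (hf x).trans (by norm_num)

lemma exists_peakFunction_separating {r r' : R} (h : r ≠ r') :
    ∃ g ∈ peakFunctions r, -g ∈ peakFunctions r' := by
  have hd : 0 < dist r r' := dist_pos.2 h
  refine ⟨⟨fun x => max (-(1 / 2)) (1 / 2 - dist r x / dist r r'), by fun_prop⟩,
    ⟨fun x => abs_le.2 ⟨le_max_left _ _, max_le (by norm_num) ?_⟩, ?_⟩, fun x => ?_, ?_⟩
  · have : 0 ≤ dist r x / dist r r' := by positivity
    linarith
  · simp
  · have : 0 ≤ dist r x / dist r r' := by positivity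
    simp only [ContinuousMap.neg_apply, ContinuousMap.coe_mk, abs_neg]
    exact abs_le.2 ⟨le_max_left _ _, max_le (by norm_num) (by linarith)⟩
  · simp [div_self hd.ne']
    norm_num

variable [MetricSpace S] {G : C(R, ℝ) → C(S, ℝ)}

lemma peakRel_injective {σ τ : ℝ} (hσ : σ = 1 ∨ σ = -1) (hτ : τ = 1 ∨ τ = -1) {r r' : R} {s : S}
    (h : (r, s) ∈ peakRel G σ) (h' : (r', s) ∈ peakRel G τ) : r = r' := by
  by_contra hne
  obtain ⟨g, hg, hg'⟩ := exists_peakFunction_separating hne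
  have h1 := h g hg
  have h2 := h' (-g) hg'
  let c : C(R, ℝ) := ContinuousMap.const R (1 / 2)
  have hc : ∀ x, c ∈ peakFunctions x := fun x => ⟨fun y => by simp [c, abs_of_pos], rfl⟩
  have h3 := h c (hc _)
  have h4 := h' c (hc _)
  simp only [neg_neg] at h2
  rcases hσ with rfl | rfl <;> rcases hτ with rfl | rfl <;> linarith

lemma isClosed_peakRel [CompactSpace S]
    (hG : ∀ f g : C(R, ℝ), ‖f‖ ≤ 1 → ‖g‖ ≤ 1 → ‖G f - G g‖ ≤ ‖f - g‖) {σ : ℝ}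
    (hσ : |σ| = 1) : IsClosed (peakRel G σ) := by
  refine isClosed_of_closure_subset fun ⟨r, s⟩ hp g ⟨hg, hgr⟩ => ?_
  obtain ⟨p, hpΓ, hlim⟩ := mem_closure_iff_seq_limit.1 hp
  have hr : Filter.Tendsto (fun n => (p n).1) Filter.atTop (nhds r) :=
    (continuous_fst.tendsto _).comp hlim
  have hs : Filter.Tendsto (fun n => (p n).2) Filter.atTop (nhds s) :=
    (continuous_snd.tendsto _).comp hlim
  let t : ℕ → ℝ := fun n => 1 / 2 - g (p n).1
  have ht0 : ∀ n, 0 ≤ t n := fun n => sub_nonneg.2 (abs_le.1 (hg _)).2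
  have ht : Filter.Tendsto t Filter.atTop (nhds 0) := by
    have := ((g.continuous.tendsto r).comp hr).const_sub (1 / 2)
    rwa [hgr, sub_self] at this
  let k : ℕ → C(R, ℝ) := fun n => ⟨fun x => min (1 / 2) (g x + t n), by fun_prop⟩
  have hk : ∀ n, k n ∈ peakFunctions (p n).1 := fun n =>
    ⟨fun x => abs_le.2 ⟨le_min (by norm_num) (by linarith [ht0 n, (abs_le.1 (hg x)).1]),
      min_le_left _ _⟩, by simp [k, t]⟩
  have hkg : ∀ n x, |k n x - g x| ≤ t n := fun n x => by
    have h1 : k n x ≤ g x + t n := min_le_right _ _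
    have h2 : g x ≤ k n x := le_min (abs_le.1 (hg x)).2 (by linarith [ht0 n])
    exact abs_le.2 ⟨by linarith [ht0 n], by linarith⟩
  have hn : ∀ n, ‖k n - g‖ ≤ t n := fun n => (ContinuousMap.norm_le _ (ht0 n)).2 (hkg n)
  have key : ∀ n, 7 / 8 - 2 * t n ≤ σ * (G g (p n).2 - G (-g) (p n).2) := fun n => by
    have h1 := hpΓ n _ (hk n)
    have h2 := ((G (k n) - G g).norm_coe_le_norm (p n).2).trans
      ((hG _ _ (norm_le_one_of_abs_le_half (hk n).1) (norm_le_one_of_abs_le_half hg)).trans (hn n))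
    have h3 := ((G (-k n) - G (-g)).norm_coe_le_norm (p n).2).trans
      (hG _ _ (by rw [norm_neg]; exact norm_le_one_of_abs_le_half (hk n).1)
        (by rw [norm_neg]; exact norm_le_one_of_abs_le_half hg))
    rw [neg_sub_neg, norm_sub_rev] at h3
    have h3 := h3.trans (hn n)
    simp only [ContinuousMap.sub_apply, Real.norm_eq_abs, abs_le] at h2 h3
    rcases eq_or_eq_neg_of_abs_eq hσ with rfl | rfl <;> linarith
  have hL : Filter.Tendsto (fun n => 7 / 8 - 2 * t n) Filter.atTop (nhds (7 / 8)) := by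
    simpa using (ht.const_mul 2).const_sub (7 / 8)
  have hc : Continuous fun y => σ * (G g y - G (-g) y) := by fun_prop
  exact le_of_tendsto_of_tendsto' hL ((hc.tendsto s).comp hs) key

lemma exists_peak_below (r : R) (u : Finset (peakFunctions r)) :
    ∃ f : C(R, ℝ), (∀ x, 0 ≤ f x ∧ f x ≤ 1) ∧ f r = 1 ∧
      ∀ g ∈ u, ∀ x, f x ≤ (g : C(R, ℝ)) x + 1 / 2 := by
  classical
  induction u using Finset.induction_on with
  | empty => exact ⟨1, by simp, rfl, by simp⟩
  | insert g u _ ih =>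
    obtain ⟨f, hf, hfr, hfu⟩ := ih
    obtain ⟨g, hg, hgr⟩ := g
    refine ⟨⟨fun x => min (f x) (g x + 1 / 2), by fun_prop⟩,
      fun x => ⟨le_min (hf x).1 (by linarith [(abs_le.1 (hg x)).1]), min_le_of_left_le (hf x).2⟩,
      ?_, ?_⟩
    · simp only [ContinuousMap.coe_mk, hfr, hgr]
      norm_num
    · rintro k hk x
      rcases Finset.mem_insert.1 hk with rfl | hk
      · exact min_le_right _ _
      · exact min_le_of_left_le (hfu k hk x)

lemma exists_mem_peakRel [CompactSpace S]
    (hG : ∀ f g : C(R, ℝ), ‖f‖ ≤ 1 → ‖g‖ ≤ 1 → ‖G f - G g‖ ≤ ‖f - g‖)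
    (hG' : ∀ f g : C(R, ℝ), ‖f‖ ≤ 1 → ‖g‖ ≤ 1 → 15 / 16 * ‖f - g‖ ≤ ‖G f - G g‖) (r : R) :
    ∃ s, (r, s) ∈ peakRel G 1 ∪ peakRel G (-1) := by
  let t : peakFunctions r → Set (S × ℝ) := fun g =>
    {p | 7 / 8 ≤ p.2 * (G g p.1 - G (-g) p.1)}
  have hK : IsCompact (Set.univ ×ˢ {1, -1} : Set (S × ℝ)) :=
    isCompact_univ.prod (Set.toFinite _).isCompact
  obtain ⟨⟨s, σ⟩, ⟨-, hσ⟩, hst⟩ := hK.inter_iInter_nonempty t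
    (fun g => isClosed_le continuous_const (by fun_prop)) fun u => by
      obtain ⟨f, hf, hfr, hfu⟩ := exists_peak_below r u
      have hf1 : ‖f‖ ≤ 1 := (ContinuousMap.norm_le _ zero_le_one).2 fun x =>
        abs_le.2 ⟨by linarith [(hf x).1], (hf x).2⟩
      have hfn : ‖-f‖ ≤ 1 := by rwa [norm_neg]
      have h2 : 2 ≤ ‖f - -f‖ := by
        have := (f - -f).norm_coe_le_norm r
        norm_num [hfr] at this
        simpa using this
      have hlow : 15 / 8 ≤ ‖G f - G (-f)‖ := by linarith [hG' f (-f) hf1 hfn]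
      obtain ⟨s, hs⟩ : ∃ s, 15 / 8 ≤ |(G f - G (-f)) s| := by
        by_contra! h
        exact hlow.not_gt ((ContinuousMap.norm_lt_iff _ (by norm_num)).2 h)
      have hnear : ∀ g ∈ u, |G f s - G g s| ≤ 1 / 2 ∧ |G (-f) s - G (-g) s| ≤ 1 / 2 := by
        intro g hg
        have hg1 := norm_le_one_of_abs_le_half g.2.1
        have hfg : ‖f - g‖ ≤ 1 / 2 := (ContinuousMap.norm_le _ (by norm_num)).2 fun x =>
          abs_le.2 ⟨by
            have := (abs_le.1 (g.2.1 x)).2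
            simp only [ContinuousMap.sub_apply]
            linarith [(hf x).1], by
            simp only [ContinuousMap.sub_apply]
            linarith [hfu g hg x]⟩
        refine ⟨((G f - G g).norm_coe_le_norm s).trans ((hG _ _ hf1 hg1).trans hfg),
          ((G (-f) - G (-g)).norm_coe_le_norm s).trans ((hG _ _ hfn (by rwa [norm_neg])).trans ?_)⟩
        rwa [neg_sub_neg, norm_sub_rev]
      simp only [ContinuousMap.sub_apply] at hs
      rcases le_abs.1 hs with hs | hs
      · refine ⟨(s, 1), by simp, Set.mem_iInter₂.2 fun g hg => ?_⟩
        obtain ⟨h3, h4⟩ := hnear g hg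
        rw [abs_le] at h3 h4
        change 7 / 8 ≤ 1 * (G g s - G (-g) s)
        linarith
      · refine ⟨(s, -1), by simp, Set.mem_iInter₂.2 fun g hg => ?_⟩
        obtain ⟨h3, h4⟩ := hnear g hg
        rw [abs_le] at h3 h4
        change 7 / 8 ≤ -1 * (G g s - G (-g) s)
        linarith
  have hmem : (r, s) ∈ peakRel G σ := fun g hg => Set.mem_iInter.1 hst ⟨g, hg⟩
  rcases hσ with rfl | rfl
  exacts [⟨s, .inl hmem⟩, ⟨s, .inr hmem⟩]

end Peak

/-- Let `R` and `S` be compact metric spaces and `B` the closed unit ball of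
`C(R, ℝ)`. Suppose `F : B → C(S, ℝ)` satisfies
`(15/16) ‖f - g‖ ≤ ‖F f - F g‖ ≤ ‖f - g‖` for all `f, g ∈ B`. Then `C(R, ℝ)` is linearly
isometric to a subspace of `C(S, ℝ)`. -/
theorem stmt7 (R S : Type*) [MetricSpace R] [CompactSpace R] [MetricSpace S] [CompactSpace S]
    (F : (Metric.closedBall (0 : C(R, ℝ)) 1) → C(S, ℝ))
    (hF : ∀ f g : Metric.closedBall (0 : C(R, ℝ)) 1,
      (15 / 16 : ℝ) * ‖(f : C(R, ℝ)) - (g : C(R, ℝ))‖ ≤ ‖F f - F g‖ ∧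
        ‖F f - F g‖ ≤ ‖(f : C(R, ℝ)) - (g : C(R, ℝ))‖) :
    Nonempty (C(R, ℝ) →ₗᵢ[ℝ] C(S, ℝ)) := by
  classical
  let G : C(R, ℝ) → C(S, ℝ) := fun f =>
    if hf : f ∈ Metric.closedBall (0 : C(R, ℝ)) 1 then F ⟨f, hf⟩ else 0
  have hGF : ∀ f g : C(R, ℝ), ‖f‖ ≤ 1 → ‖g‖ ≤ 1 →
      15 / 16 * ‖f - g‖ ≤ ‖G f - G g‖ ∧ ‖G f - G g‖ ≤ ‖f - g‖ := fun f g hf hg => by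
    rw [← mem_closedBall_zero_iff] at hf hg
    simpa only [G, dif_pos hf, dif_pos hg] using hF ⟨f, hf⟩ ⟨g, hg⟩
  have hlip := fun f g hf hg => (hGF f g hf hg).2
  refine nonempty_linearIsometry_of_isClosed_rel (Γ := peakRel G 1 ∪ peakRel G (-1))
    ((isClosed_peakRel hlip (by simp)).union (isClosed_peakRel hlip (by simp)))
    (exists_mem_peakRel hlip fun f g hf hg => (hGF f g hf hg).1) ?_
  rintro r r' s (h | h) (h' | h') <;> exact peakRel_injective (by simp) (by simp) h h'
end

section
/- Let X be a finite-dimensional real normed space that is polyhedral, meaning there exist norm-one continuous linear functionals x₁*, …, x_k* on X such that the closed unit ball of X equals the intersection over i = 1, …, k of the sets {x ∈ X : |x_i*(x)| ≤ 1}. Then for every real Banach space Y, if there exists a distance-preserving map from the closed unit ball of X into Y, then there exists a linear isometric embedding of X into Y. -/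
open Filter Topology Metric MeasureTheory

/-- Mollifying a Lipschitz map and differentiating at the origin gives a linear map of no larger
norm, through which every functional that is affine along the original map factors. -/
theorem LipschitzOnWith.exists_linearization {X Y : Type*} [NormedAddCommGroup X]
    [NormedSpace ℝ X] [FiniteDimensional ℝ X] [NormedAddCommGroup Y] [NormedSpace ℝ Y]
    [CompleteSpace Y] {C : NNReal} {f : X → Y} {r : ℝ} (hr : 0 < r)
    (hf : LipschitzOnWith C f (closedBall 0 r)) :
    ∃ S : X →L[ℝ] Y, ‖S‖ ≤ C ∧ ∀ (l : Y →L[ℝ] ℝ) (g : X →L[ℝ] ℝ) (c : ℝ),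
      (∀ x ∈ closedBall (0 : X) r, l (f x) = g x + c) → ∀ x, l (S x) = g x := by
  let _ : MeasurableSpace X := borel X
  have : BorelSpace X := ⟨rfl⟩
  let μ : Measure X := Measure.addHaar
  let φ : ContDiffBump (0 : X) := ⟨r / 4, r / 2, by positivity, by linarith⟩
  let f₀ : X → Y := (closedBall (0 : X) r).indicator f
  have hf₀ : LocallyIntegrable f₀ μ :=
    ((hf.continuousOn.integrableOn_compact (isCompact_closedBall _ _)).integrable_indicator
      measurableSet_closedBall).locallyIntegrable
  let L := ContinuousLinearMap.lsmul ℝ ℝ (E := Y)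
  let F : X → Y := convolution (φ.normed μ) f₀ L μ
  have hF : ContDiff ℝ 1 F :=
    φ.hasCompactSupport_normed.contDiff_convolution_left L φ.contDiff_normed hf₀
  have hint (x : X) : Integrable (fun t ↦ φ.normed μ t • f₀ (x - t)) μ :=
    (φ.hasCompactSupport_normed.convolutionExists_left L φ.continuous_normed hf₀ x)
  have hsub (x x' : X) : F x - F x' = ∫ t, φ.normed μ t • (f₀ (x - t) - f₀ (x' - t)) ∂μ := by
    simp only [smul_sub]
    exact (integral_sub (hint x) (hint x')).symm
  have hintsub (x x' : X) : Integrable (fun t ↦ φ.normed μ t • (f₀ (x - t) - f₀ (x' - t))) μ := by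
    simp only [smul_sub]
    exact (hint x).sub (hint x')
  have hmem {x t : X} (hx : x ∈ ball (0 : X) (r / 2)) (ht : φ.normed μ t ≠ 0) :
      x - t ∈ closedBall (0 : X) r := by
    have ht' : t ∈ ball (0 : X) (r / 2) := by
      have := Function.mem_support.2 ht
      rwa [φ.support_normed_eq] at this
    rw [mem_ball_zero_iff] at hx ht'
    rw [mem_closedBall_zero_iff]
    linarith [_root_.norm_sub_le x t]
  have hlip : LipschitzOnWith C F (ball 0 (r / 2)) := by
    refine LipschitzOnWith.of_dist_le_mul fun x hx x' hx' ↦ ?_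
    rw [dist_eq_norm, dist_eq_norm, hsub]
    calc _ ≤ ∫ t, φ.normed μ t * (C * ‖x - x'‖) ∂μ := by
            refine norm_integral_le_of_norm_le (φ.integrable_normed.mul_const _)
              (Eventually.of_forall fun t ↦ ?_)
            rw [norm_smul, Real.norm_of_nonneg (φ.nonneg_normed t)]
            by_cases ht : φ.normed μ t = 0
            · simp [ht]
            refine mul_le_mul_of_nonneg_left ?_ (φ.nonneg_normed t)
            simp only [f₀, Set.indicator_of_mem (hmem hx ht), Set.indicator_of_mem (hmem hx' ht)]
            simpa [dist_eq_norm] using hf.dist_le_mul _ (hmem hx ht) _ (hmem hx' ht)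
      _ = C * ‖x - x'‖ := by rw [integral_mul_const, φ.integral_normed, one_mul]
  have hnhds : ball (0 : X) (r / 2) ∈ 𝓝 0 := ball_mem_nhds _ (by positivity)
  have hderiv : HasFDerivAt F (fderiv ℝ F 0) 0 :=
    (hF.differentiable (by norm_num)).differentiableAt.hasFDerivAt
  refine ⟨fderiv ℝ F 0, hderiv.le_of_lipschitzOn hnhds hlip, fun l g c hl ↦ ?_⟩
  have haff : ∀ x ∈ ball (0 : X) (r / 2), l (F x) = g x + l (F 0) := by
    intro x hx
    rw [← sub_eq_iff_eq_add, ← map_sub, hsub, ← l.integral_comp_comm (hintsub x 0)]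
    calc _ = ∫ t, φ.normed μ t * g x ∂μ := by
            congr 1 with t
            by_cases ht : φ.normed μ t = 0
            · simp [ht]
            have h0 := hmem (mem_of_mem_nhds hnhds) ht
            simp only [f₀, Set.indicator_of_mem (hmem hx ht), Set.indicator_of_mem h0, map_smul,
              map_sub, hl _ (hmem hx ht), hl _ h0, smul_eq_mul]
            simp
      _ = g x := by rw [integral_mul_const, φ.integral_normed, one_mul]
  have hg : HasFDerivAt (fun x ↦ l (F x)) g 0 :=
    (g.hasFDerivAt.add_const (l (F 0))).congr_of_eventuallyEq (eventually_of_mem hnhds haff)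
  have hcomp : l.comp (fderiv ℝ F 0) = g := (l.hasFDerivAt.comp 0 hderiv).unique hg
  exact fun x ↦ DFunLike.congr_fun hcomp x

/-- If the norm agrees to first order with a functional `g` near a unit vector, then some
functional of norm at most one linearizes any isometry of the unit ball along `g`. -/
theorem exists_functional_comp_eventually_affine {X Y : Type*} [NormedAddCommGroup X]
    [NormedSpace ℝ X] [NormedAddCommGroup Y] [NormedSpace ℝ Y] {f : X → Y}
    (hf : ∀ x ∈ closedBall (0 : X) 1, ∀ y ∈ closedBall (0 : X) 1, dist (f x) (f y) = dist x y)
    {g : X →L[ℝ] ℝ} {u : X} (hu : ‖u‖ = 1) (hug : ∀ᶠ x in 𝓝 (0 : X), ‖u - x‖ ≤ 1 - g x) :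
    ∃ l : Y →L[ℝ] ℝ, ‖l‖ ≤ 1 ∧ ∃ c : ℝ, ∀ᶠ x in 𝓝 (0 : X), l (f x) = g x + c := by
  obtain ⟨l, hl, hlu⟩ := exists_dual_vector'' ℝ (f u - f (-u))
  have hu1 : u ∈ closedBall (0 : X) 1 := by simp [hu]
  have hu2 : -u ∈ closedBall (0 : X) 1 := by simp [hu]
  have h2 : l (f u) - l (f (-u)) = 2 := by
    rw [← map_sub, hlu, RCLike.ofReal_real_eq_id, id, ← dist_eq_norm, hf _ hu1 _ hu2,
      dist_eq_norm, sub_neg_eq_add, ← two_smul ℝ u, norm_smul, hu]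
    norm_num
  have hneg : ∀ᶠ x in 𝓝 (0 : X), ‖u - -x‖ ≤ 1 - g (-x) :=
    (continuous_neg.tendsto' (0 : X) 0 neg_zero).eventually hug
  refine ⟨l, hl, l (f u) - 1, ?_⟩
  filter_upwards [hug, hneg, closedBall_mem_nhds (0 : X) one_pos] with x h₁ h₃ hx
  have hle (y z : Y) : l y - l z ≤ dist y z := by
    rw [← map_sub, dist_eq_norm]
    exact (le_abs_self _).trans ((l.le_of_opNorm_le hl _).trans_eq (one_mul _))
  have e₁ := (hle (f u) (f x)).trans_eq ((hf _ hu1 _ hx).trans (dist_eq_norm _ _))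
  have e₂ := (hle (f x) (f (-u))).trans_eq ((hf _ hx _ hu2).trans (dist_eq_norm _ _))
  rw [show x - -u = u - -x by abel] at e₂
  rw [map_neg] at h₃
  linarith

/-- A finite norming family of functionals has a norming subfamily each of whose members
describes the norm near some unit vector. -/
theorem exists_norming_subfamily {X ι : Type*} [NormedAddCommGroup X] [NormedSpace ℝ X]
    [Fintype ι] {g : ι → X →L[ℝ] ℝ} (hg : ∀ i, ‖g i‖ ≤ 1)
    (hnorming : ∀ x ≠ 0, ∃ i, ‖x‖ ≤ |g i x|) :
    ∃ I : Finset ι, (∀ x ≠ 0, ∃ i ∈ I, ‖x‖ ≤ |g i x|) ∧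
      ∀ i ∈ I, ∃ u : X, ‖u‖ = 1 ∧ ∀ᶠ x in 𝓝 (0 : X), ‖u - x‖ ≤ 1 - g i x := by
  classical
  obtain ⟨I, -, hI⟩ := exists_minimal_le_of_wellFoundedLT
    (fun I : Finset ι ↦ ∀ x ≠ 0, ∃ i ∈ I, ‖x‖ ≤ |g i x|) Finset.univ (by simpa using hnorming)
  refine ⟨I, hI.prop, fun i hi ↦ ?_⟩
  have hle (j : ι) (x : X) : |g j x| ≤ ‖x‖ :=
    ((g j).le_of_opNorm_le (hg j) x).trans_eq (one_mul _)
  have hnot := hI.not_prop_of_lt (Finset.erase_ssubset hi)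
  push Not at hnot
  obtain ⟨v, hv0, hv⟩ := hnot
  have hvi : |g i v| = ‖v‖ := by
    obtain ⟨j, hj, hvj⟩ := hI.prop v hv0
    by_cases hji : j = i
    · exact le_antisymm (hle i v) (hji ▸ hvj)
    · exact absurd hvj (hv j (Finset.mem_erase.2 ⟨hji, hj⟩)).not_ge
  have hpos : 0 < ‖v‖ := norm_pos_iff.2 hv0
  have hgv : g i v ≠ 0 := fun h ↦ hpos.ne (by simpa [h] using hvi)
  set u : X := (g i v)⁻¹ • v with hu_def
  have hgu (j : ι) : |g j u| = |g j v| / ‖v‖ := by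
    rw [hu_def, map_smul, smul_eq_mul, abs_mul, abs_inv, hvi]
    field_simp
  have hui : g i u = 1 := by simp [hu_def, hgv]
  have hu : ‖u‖ = 1 := by
    rw [hu_def, norm_smul, norm_inv, Real.norm_eq_abs, hvi, inv_mul_cancel₀ hpos.ne']
  refine ⟨u, hu, ?_⟩
  have hev : ∀ᶠ x in 𝓝 (0 : X), ∀ j ∈ I.erase i, |g j (u - x)| < g i (u - x) := by
    rw [Filter.eventually_all_finset]
    intro j hj
    refine ContinuousAt.eventually_lt (by fun_prop) (by fun_prop) ?_
    rw [sub_zero, hui, hgu, div_lt_one hpos]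
    exact hv j hj
  have hev' : ∀ᶠ x in 𝓝 (0 : X), 0 < g i (u - x) :=
    ContinuousAt.eventually_lt (by fun_prop) (by fun_prop) (by simp [hui])
  filter_upwards [hev, hev'] with x hx hx'
  obtain ⟨j, hj, hxj⟩ := hI.prop (u - x) fun h ↦ by simp [h] at hx'
  by_cases hji : j = i
  · rw [hji, abs_of_pos hx', map_sub, hui] at hxj
    exact hxj
  · have := hx j (Finset.mem_erase.2 ⟨hji, hj⟩)
    linarith [le_abs_self (g i (u - x)), hle i (u - x)]

/-- Finitely many functionals cutting out the closed unit ball attain the norm of each vector. -/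
theorem exists_norm_le_abs_of_closedBall_eq_iInter {X ι : Type*} [NormedAddCommGroup X]
    [NormedSpace ℝ X] [Finite ι] {g : ι → X →L[ℝ] ℝ}
    (hball : closedBall (0 : X) 1 = ⋂ i, {x : X | |g i x| ≤ 1}) (x : X) (hx : x ≠ 0) :
    ∃ i, ‖x‖ ≤ |g i x| := by
  by_contra! h
  have hev : ∀ᶠ c in 𝓝[<] ‖x‖, ∀ i, |g i x| < c :=
    eventually_all.2 fun i ↦ nhdsWithin_le_nhds (eventually_gt_nhds (h i))
  obtain ⟨c, ⟨hc, hc0⟩, hcx⟩ := ((hev.and (nhdsWithin_le_nhds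
    (eventually_gt_nhds (norm_pos_iff.2 hx)))).and self_mem_nhdsWithin).exists
  have hmem : c⁻¹ • x ∈ closedBall (0 : X) 1 := by
    rw [hball, Set.mem_iInter]
    intro i
    rw [Set.mem_ofPred_eq, map_smul, smul_eq_mul, abs_mul, abs_inv, abs_of_pos hc0,
      inv_mul_le_one₀ hc0]
    exact (hc i).le
  rw [mem_closedBall_zero_iff, norm_smul, norm_inv, Real.norm_of_nonneg hc0.le,
    inv_mul_le_one₀ hc0] at hmem
  exact absurd hcx hmem.not_gt

/-- Let `X` be a finite-dimensional polyhedral real normed space, i.e. there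
are norm-one functionals `x₁*, …, x_k*` with `B_X = ⋂ᵢ {x : |xᵢ* x| ≤ 1}`. If a real Banach
space `Y` contains an isometric copy of the closed unit ball of `X`, then `X` is linearly
isometric to a subspace of `Y`. -/
theorem stmt8 (X : Type*) [NormedAddCommGroup X] [NormedSpace ℝ X] [FiniteDimensional ℝ X]
    (k : ℕ) (xs : Fin k → (X →L[ℝ] ℝ)) (hxs : ∀ i, ‖xs i‖ = 1)
    (hball : Metric.closedBall (0 : X) 1 = ⋂ i, {x : X | |xs i x| ≤ 1})
    (Y : Type*) [NormedAddCommGroup Y] [NormedSpace ℝ Y] [CompleteSpace Y]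
    (h : ∃ j : (Metric.closedBall (0 : X) 1) → Y, Isometry j) :
    Nonempty (X →ₗᵢ[ℝ] Y) := by
  classical
  obtain ⟨j, hj⟩ := h
  let f : X → Y := fun x ↦ if hx : x ∈ closedBall (0 : X) 1 then j ⟨x, hx⟩ else 0
  have hf : ∀ x ∈ closedBall (0 : X) 1, ∀ y ∈ closedBall (0 : X) 1,
      dist (f x) (f y) = dist x y := by
    intro x hx y hy
    simp only [f, dif_pos hx, dif_pos hy, hj.dist_eq, Subtype.dist_eq]
  obtain ⟨I, hI, hI'⟩ := exists_norming_subfamily (fun i ↦ (hxs i).le)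
    (exists_norm_le_abs_of_closedBall_eq_iInter hball)
  choose! u hu hug using hI'
  choose! l hl c hc using fun i hi ↦
    exists_functional_comp_eventually_affine hf (hu i hi) (hug i hi)
  have hev : ∀ᶠ x in 𝓝 (0 : X), x ∈ closedBall (0 : X) 1 ∧ ∀ i ∈ I, l i (f x) = xs i x + c i :=
    (show ∀ᶠ x in 𝓝 (0 : X), x ∈ closedBall (0 : X) 1 from closedBall_mem_nhds _ one_pos).and
      ((Filter.eventually_all_finset I).2 hc)
  obtain ⟨r, hr, hsub⟩ := nhds_basis_closedBall.eventually_iff.1 hev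
  have hlip : LipschitzOnWith 1 f (closedBall 0 r) :=
    LipschitzOnWith.of_dist_le_mul fun x hx y hy ↦ by
      simp [hf x (hsub hx).1 y (hsub hy).1]
  obtain ⟨S, hS, hS'⟩ := hlip.exists_linearization hr
  refine ⟨⟨S.toLinearMap, fun x ↦ le_antisymm ?_ ?_⟩⟩
  · simpa using S.le_of_opNorm_le hS x
  · rcases eq_or_ne x 0 with rfl | hx
    · simp
    obtain ⟨i, hi, hxi⟩ := hI x hx
    rw [← hS' (l i) (xs i) (c i) (fun z hz ↦ (hsub hz).2 i hi) x] at hxi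
    exact hxi.trans (((l i).le_of_opNorm_le (hl i hi) _).trans_eq (one_mul _))
end

section
/- Let c₀ denote the Banach space of real sequences converging to 0, with the supremum norm. For every real Banach space Y, if there exists a distance-preserving map from the closed unit ball of c₀ into Y, then there exists a linear isometric embedding of c₀ into Y. -/
open ZeroAtInfty

open MeasureTheory Filter Topology unitInterval

namespace CZero

variable {Y : Type*} [NormedAddCommGroup Y] [NormedSpace ℝ Y]

/-- A null sequence, as an element of `C₀(ℕ, ℝ)`. -/
def ofSeq (a : ℕ → ℝ) (ha : Tendsto a atTop (𝓝 0)) : C₀(ℕ, ℝ) where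
  toFun := a
  continuous_toFun := continuous_of_discreteTopology
  zero_at_infty' := by rwa [cocompact_eq_cofinite, Nat.cofinite_eq_atTop]

@[simp]
theorem ofSeq_apply (a : ℕ → ℝ) (ha : Tendsto a atTop (𝓝 0)) (n : ℕ) : ofSeq a ha n = a n := rfl

theorem tendsto_coe (x : C₀(ℕ, ℝ)) : Tendsto x atTop (𝓝 0) := by
  rw [← Nat.cofinite_eq_atTop, ← cocompact_eq_cofinite]
  exact x.zero_at_infty'

theorem norm_le_iff {x : C₀(ℕ, ℝ)} {C : ℝ} (hC : 0 ≤ C) : ‖x‖ ≤ C ↔ ∀ n, |x n| ≤ C := by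
  rw [← ZeroAtInftyContinuousMap.norm_toBCF_eq_norm, BoundedContinuousFunction.norm_le hC]
  rfl

theorem abs_apply_le_norm (x : C₀(ℕ, ℝ)) (n : ℕ) : |x n| ≤ ‖x‖ :=
  (norm_le_iff (norm_nonneg x)).1 le_rfl n

/-- The unit vector basis of `C₀(ℕ, ℝ)`. -/
def unitVec (i : ℕ) : C₀(ℕ, ℝ) :=
  ofSeq (Pi.single i 1) (tendsto_const_nhds.congr' <| by
    filter_upwards [eventually_gt_atTop i] with n hn
    rw [Pi.single_eq_of_ne hn.ne'])

theorem unitVec_apply (i n : ℕ) : unitVec i n = if n = i then 1 else 0 := by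
  simp [unitVec, Pi.single_apply]

theorem norm_unitVec_le (i : ℕ) : ‖unitVec i‖ ≤ 1 :=
  (norm_le_iff zero_le_one).2 fun n => by rw [unitVec_apply]; split_ifs <;> simp

theorem sum_smul_unitVec_apply (s : Finset ℕ) (b : ℕ → ℝ) (n : ℕ) :
    (∑ i ∈ s, b i • unitVec i) n = if n ∈ s then b n else 0 := by
  induction s using Finset.induction_on with
  | empty => simp
  | insert i s hi ih =>
    rw [Finset.sum_insert hi, ZeroAtInftyContinuousMap.add_apply, ih,
      ZeroAtInftyContinuousMap.smul_apply, unitVec_apply]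
    by_cases h : n = i
    · subst h; simp [hi]
    · simp [h]

/-- Coordinatewise truncation to `[-1, 1]`. -/
def clamp (x : C₀(ℕ, ℝ)) : C₀(ℕ, ℝ) :=
  ofSeq (fun n => max (-1) (min 1 (x n))) <| by
    have h : Continuous fun t : ℝ => max (-1) (min 1 t) := by fun_prop
    simpa [Function.comp_def] using (h.tendsto 0).comp (tendsto_coe x)

theorem norm_clamp_le (x : C₀(ℕ, ℝ)) : ‖clamp x‖ ≤ 1 :=
  (norm_le_iff zero_le_one).2 fun n =>
    abs_le.2 ⟨le_max_left _ _, max_le (by norm_num) (min_le_left _ _)⟩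

theorem clamp_eq_self {x : C₀(ℕ, ℝ)} (hx : ‖x‖ ≤ 1) : clamp x = x := by
  ext n
  have h := abs_le.1 ((abs_apply_le_norm x n).trans hx)
  simp [clamp, min_eq_right h.2, max_eq_right h.1]

theorem norm_clamp_sub_le (x y : C₀(ℕ, ℝ)) : ‖clamp x - clamp y‖ ≤ ‖x - y‖ :=
  (norm_le_iff (norm_nonneg _)).2 fun n => by
    have h1 := abs_max_sub_max_le_max (-1) (min 1 (x n)) (-1) (min 1 (y n))
    have h2 := abs_min_sub_min_le_max 1 (x n) 1 (y n)
    rw [sub_self, abs_zero] at h1 h2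
    exact ((h1.trans_eq (max_eq_right (abs_nonneg _))).trans
      (h2.trans_eq (max_eq_right (abs_nonneg _)))).trans (abs_apply_le_norm (x - y) n)

/-- A functional norming the difference of the images of `unitVec n` and `-unitVec n` reads off
the `n`-th coordinate on the half ball. -/
theorem exists_coordinate_functional {F : C₀(ℕ, ℝ) → Y}
    (hF : ∀ x y, ‖x‖ ≤ 1 → ‖y‖ ≤ 1 → ‖F x - F y‖ = ‖x - y‖) (n : ℕ) :
    ∃ φ : StrongDual ℝ Y, ‖φ‖ ≤ 1 ∧
      ∀ x y, ‖x‖ ≤ 1 / 2 → ‖y‖ ≤ 1 / 2 → φ (F x - F y) = x n - y n := by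
  obtain ⟨φ, hφ, hφe⟩ := exists_dual_vector'' ℝ (F (unitVec n) - F (-unitVec n))
  have hφle : ∀ y, φ y ≤ ‖y‖ := fun y =>
    (le_abs_self _).trans ((φ.le_opNorm y).trans (mul_le_of_le_one_left (norm_nonneg y) hφ))
  have hneg : ‖-unitVec n‖ ≤ 1 := by rw [norm_neg]; exact norm_unitVec_le n
  have htwo : 2 ≤ φ (F (unitVec n) - F (-unitVec n)) := by
    rw [hφe, hF _ _ (norm_unitVec_le n) hneg]
    have := abs_apply_le_norm (unitVec n - -unitVec n) n
    simp only [ZeroAtInftyContinuousMap.sub_apply, ZeroAtInftyContinuousMap.neg_apply,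
      unitVec_apply] at this
    norm_num at this
    simpa using this
  have key : ∀ x, ‖x‖ ≤ 1 / 2 → φ (F x) = φ (F (-unitVec n)) + 1 + x n := by
    intro x hx
    have hx1 : ‖x‖ ≤ 1 := hx.trans (by norm_num)
    have hc : ∀ k, -(1 / 2) ≤ x k ∧ x k ≤ 1 / 2 := fun k =>
      abs_le.1 ((abs_apply_le_norm x k).trans hx)
    have h1 : ‖unitVec n - x‖ ≤ 1 - x n := by
      refine (norm_le_iff (by linarith [hc n])).2 fun k => ?_
      rw [ZeroAtInftyContinuousMap.sub_apply, unitVec_apply, abs_le]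
      split_ifs with h
      · subst h; constructor <;> linarith [hc k]
      · constructor <;> linarith [hc k, hc n]
    have h2 : ‖x - -unitVec n‖ ≤ 1 + x n := by
      refine (norm_le_iff (by linarith [hc n])).2 fun k => ?_
      rw [ZeroAtInftyContinuousMap.sub_apply, ZeroAtInftyContinuousMap.neg_apply, unitVec_apply,
        abs_le]
      split_ifs with h
      · subst h; constructor <;> linarith [hc k]
      · constructor <;> linarith [hc k, hc n]
    have h3 := hφle (F (unitVec n) - F x)
    have h4 := hφle (F x - F (-unitVec n))
    rw [hF _ _ (norm_unitVec_le n) hx1] at h3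
    rw [hF _ _ hx1 hneg] at h4
    rw [map_sub] at h3 h4 htwo
    linarith
  refine ⟨φ, hφ, fun x y hx hy => ?_⟩
  rw [map_sub, key x hx, key y hy]
  ring

/-- The weights of the random perturbation. -/
noncomputable def weight (k : ℕ) : ℝ := (1 / 4) * (1 / 2) ^ k

theorem weight_pos (k : ℕ) : 0 < weight k := by unfold weight; positivity

theorem weight_le (k : ℕ) : weight k ≤ 1 / 4 :=
  mul_le_of_le_one_right (by norm_num) (pow_le_one₀ (by norm_num) (by norm_num))

theorem tendsto_weight : Tendsto weight atTop (𝓝 0) := by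
  have h := (tendsto_pow_atTop_nhds_zero_of_lt_one (r := (1 / 2 : ℝ)) (by norm_num)
    (by norm_num)).const_mul (1 / 4)
  rwa [mul_zero] at h

theorem abs_weight_mul_le (k : ℕ) (t : I) : |weight k * t| ≤ weight k := by
  rw [abs_of_nonneg (mul_nonneg (weight_pos k).le t.2.1)]
  exact mul_le_of_le_one_right (weight_pos k).le t.2.2

/-- The embedding of the Hilbert cube into `C₀(ℕ, ℝ)` as a box with side lengths `weight`. -/
noncomputable def box (ω : ℕ → I) : C₀(ℕ, ℝ) :=
  ofSeq (fun k => weight k * ω k)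
    (squeeze_zero_norm (fun k => abs_weight_mul_le k (ω k)) tendsto_weight)

theorem norm_box_le (ω : ℕ → I) : ‖box ω‖ ≤ 1 / 4 :=
  (norm_le_iff (by norm_num)).2 fun k => (abs_weight_mul_le k (ω k)).trans (weight_le k)

theorem continuous_box : Continuous box := by
  refine continuous_iff_continuousAt.2 fun ω => Metric.tendsto_nhds.2 fun ε hε => ?_
  obtain ⟨N, hN⟩ := eventually_atTop.1 (tendsto_weight.eventually_lt_const (half_pos hε))
  have hfin : ∀ᶠ ω' in 𝓝 ω, ∀ k ∈ Finset.range N, |weight k * ω' k - weight k * ω k| < ε / 2 := by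
    refine (Finset.eventually_all _).2 fun k _ => ?_
    have hc : Continuous fun ω' : ℕ → I => weight k * (ω' k : ℝ) := by fun_prop
    exact Metric.tendsto_nhds.1 (hc.tendsto ω) _ (half_pos hε)
  filter_upwards [hfin] with ω' h
  rw [dist_eq_norm]
  refine ((norm_le_iff (half_pos hε).le).2 fun k => ?_).trans_lt (half_lt_self hε)
  rcases lt_or_ge k N with hk | hk
  · exact (h k (Finset.mem_range.2 hk)).le
  · refine le_trans ?_ (hN k hk).le
    have h0 := weight_pos k
    have h1 := (ω k).2
    have h2 := (ω' k).2
    simp only [box, ZeroAtInftyContinuousMap.sub_apply, ofSeq_apply]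
    rw [abs_le]
    constructor <;> nlinarith [h1.1, h1.2, h2.1, h2.2]

theorem box_update (ω : ℕ → I) (i : ℕ) (s : I) :
    box (Function.update ω i s) = box (Function.update ω i 0) + (weight i * s) • unitVec i := by
  ext k
  simp only [box, ZeroAtInftyContinuousMap.add_apply, ofSeq_apply,
    ZeroAtInftyContinuousMap.smul_apply, unitVec_apply]
  by_cases h : k = i
  · subst h; simp
  · simp [h]

/-- The uniform probability measure on the Hilbert cube. -/
noncomputable abbrev cubeMeasure : Measure (ℕ → I) := Measure.infinitePi fun _ => volume

theorem measurePreserving_update (i : ℕ) :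
    MeasurePreserving (fun p : (ℕ → I) × I => Function.update p.1 i p.2)
      (cubeMeasure.prod volume) cubeMeasure := by
  have hm : Measurable fun p : (ℕ → I) × I => Function.update p.1 i p.2 := by
    refine measurable_pi_iff.2 fun k => ?_
    by_cases h : k = i
    · subst h; simpa using measurable_snd
    · simpa [h, Function.comp_def] using (measurable_pi_apply k).comp measurable_fst
  refine ⟨hm, Measure.eq_infinitePi _ fun s t ht => ?_⟩
  rw [Measure.map_apply hm (.pi s.countable_toSet fun k _ => ht k)]
  have hpre : (fun p : (ℕ → I) × I => Function.update p.1 i p.2) ⁻¹' (s : Set ℕ).pi t =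
      ((s.erase i : Finset ℕ) : Set ℕ).pi t ×ˢ (if i ∈ s then t i else Set.univ) := by
    ext ⟨ω, u⟩
    simp only [Set.mem_preimage, Set.mem_pi, Set.mem_prod, Finset.mem_coe, Finset.mem_erase]
    constructor
    · refine fun h => ⟨fun k hk => by simpa [hk.1] using h k hk.2, ?_⟩
      split_ifs with hi
      · simpa using h i hi
      · trivial
    · rintro ⟨h1, h2⟩ k hk
      by_cases hki : k = i
      · subst hki; simpa [hk] using h2
      · simpa [hki] using h1 k ⟨hki, hk⟩
  rw [hpre, Measure.prod_prod, Measure.infinitePi_pi _ fun k _ => ht k]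
  split_ifs with hi
  · exact Finset.prod_erase_mul s (fun k => volume (t k)) hi
  · rw [Finset.erase_eq_of_notMem hi]; simp

omit [NormedSpace ℝ Y] in
theorem integrable_cube {H : (ℕ → I) → Y} (hH : Continuous H) : Integrable H cubeMeasure :=
  hH.integrable_of_hasCompactSupport (HasCompactSupport.of_compactSpace H)

theorem integral_cube_eq_integral_update {H : (ℕ → I) → Y} (hH : Continuous H) (i : ℕ) :
    ∫ ω, H ω ∂cubeMeasure = ∫ ω, (∫ s : I, H (Function.update ω i s)) ∂cubeMeasure := by
  have hmp := measurePreserving_update i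
  have hint := integrable_cube hH
  have hprod := integral_prod _ (hmp.integrable_comp_of_integrable hint)
  simp only [Function.comp_apply] at hprod
  rw [← hprod, ← integral_map hmp.measurable.aemeasurable
    (by rw [hmp.map_eq]; exact hint.aestronglyMeasurable), hmp.map_eq]

theorem integral_unitInterval (g : ℝ → Y) : ∫ s : I, g s = ∫ s in (0 : ℝ)..1, g s := by
  rw [intervalIntegral.integral_of_le zero_le_one, ← integral_Icc_eq_integral_Ioc]
  exact integral_subtype_comap measurableSet_Icc g

/-- The difference quotient of the average of a Lipschitz function over an interval. -/
theorem norm_integral_shift_sub_le [CompleteSpace Y] {g : ℝ → Y}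
    (hg : ∀ u v, ‖g u - g v‖ ≤ |u - v|) {c : ℝ} (hc : 0 < c) (t : ℝ) :
    ‖(∫ s : I, (g (t + c * s) - g (c * s))) - t • c⁻¹ • (g c - g 0)‖ ≤ 2 / c * t ^ 2 := by
  have hcont : Continuous g := (LipschitzWith.of_dist_le_mul (K := 1) fun u v => by
    simpa [dist_eq_norm] using hg u v).continuous
  have hi : ∀ a b : ℝ, IntervalIntegrable g volume a b := hcont.intervalIntegrable
  have h1 : (∫ s : I, (g (t + c * s) - g (c * s))) =
      c⁻¹ • ∫ u in (0 : ℝ)..t, (g (c + u) - g u) := by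
    rw [integral_unitInterval fun s => g (t + c * s) - g (c * s),
      intervalIntegral.integral_sub (Continuous.intervalIntegrable (by fun_prop) _ _)
        (Continuous.intervalIntegrable (by fun_prop) _ _),
      intervalIntegral.integral_comp_add_mul g hc.ne',
      intervalIntegral.integral_comp_mul_left g hc.ne',
      intervalIntegral.integral_sub (Continuous.intervalIntegrable (by fun_prop) _ _) (hi _ _),
      intervalIntegral.integral_comp_add_left, ← smul_sub,
      intervalIntegral.integral_interval_sub_interval_comm' (hi _ _) (hi _ _) (hi _ _)]
    simp [add_comm]
  have h2 : t • c⁻¹ • (g c - g 0) = c⁻¹ • ∫ _ in (0 : ℝ)..t, (g c - g 0) := by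
    rw [intervalIntegral.integral_const, sub_zero, smul_comm]
  rw [h1, h2, ← smul_sub, ← intervalIntegral.integral_sub
    (Continuous.intervalIntegrable (by fun_prop) _ _) intervalIntegrable_const, norm_smul,
    Real.norm_of_nonneg (inv_nonneg.2 hc.le)]
  have h3 : ‖∫ u in (0 : ℝ)..t, (g (c + u) - g u - (g c - g 0))‖ ≤ 2 * |t| * |t - 0| := by
    refine intervalIntegral.norm_integral_le_of_norm_le_const fun u hu => ?_
    have hu' : |u| ≤ |t| := by
      have := Set.abs_sub_left_of_mem_uIcc (Set.uIoc_subset_uIcc hu)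
      simpa using this
    calc ‖g (c + u) - g u - (g c - g 0)‖ = ‖(g (c + u) - g c) - (g u - g 0)‖ := by congr 1; abel
      _ ≤ |c + u - c| + |u - 0| := (norm_sub_le _ _).trans (add_le_add (hg _ _) (hg _ _))
      _ ≤ 2 * |t| := by rw [add_sub_cancel_left, sub_zero]; linarith
  calc c⁻¹ * _ ≤ c⁻¹ * (2 * |t| * |t - 0|) := by gcongr
    _ = 2 / c * t ^ 2 := by rw [sub_zero, mul_assoc, abs_mul_abs_self]; ring

/-- The average of `F` over translates of the box. -/
noncomputable def boxAverage (F : C₀(ℕ, ℝ) → Y) (x : C₀(ℕ, ℝ)) : Y :=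
  ∫ ω, F (x + box ω) ∂cubeMeasure

/-- The partial derivative of `boxAverage F` in the direction `unitVec i`. -/
noncomputable def boxDeriv (F : C₀(ℕ, ℝ) → Y) (i : ℕ) (x : C₀(ℕ, ℝ)) : Y :=
  ∫ ω, (weight i)⁻¹ • (F (x + box (Function.update ω i 1)) - F (x + box (Function.update ω i 0)))
    ∂cubeMeasure

section Lipschitz

variable {F : C₀(ℕ, ℝ) → Y} (hF : LipschitzWith 1 F)

include hF

omit [NormedSpace ℝ Y] in
theorem norm_image_sub_le (x y : C₀(ℕ, ℝ)) : ‖F x - F y‖ ≤ ‖x - y‖ := by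
  simpa using hF.norm_sub_le x y

omit [NormedSpace ℝ Y] in
theorem integrable_box (x : C₀(ℕ, ℝ)) : Integrable (fun ω => F (x + box ω)) cubeMeasure :=
  integrable_cube (hF.continuous.comp (continuous_const.add continuous_box))

omit [NormedSpace ℝ Y] in
theorem continuous_box_update (x : C₀(ℕ, ℝ)) (i : ℕ) (s : I) :
    Continuous fun ω => F (x + box (Function.update ω i s)) :=
  hF.continuous.comp (continuous_const.add (continuous_box.comp
    (continuous_id.update i continuous_const)))

theorem integrable_boxDeriv (x : C₀(ℕ, ℝ)) (i : ℕ) :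
    Integrable (fun ω => (weight i)⁻¹ • (F (x + box (Function.update ω i 1)) -
      F (x + box (Function.update ω i 0)))) cubeMeasure :=
  integrable_cube (((continuous_box_update hF x i 1).sub
    (continuous_box_update hF x i 0)).const_smul _)

theorem norm_boxAverage_sub_le (x y : C₀(ℕ, ℝ)) :
    ‖boxAverage F x - boxAverage F y‖ ≤ ‖x - y‖ := by
  rw [boxAverage, boxAverage, ← integral_sub (integrable_box hF x) (integrable_box hF y)]
  refine (norm_integral_le_of_norm_le_const (.of_forall fun ω => ?_)).trans_eq
    (by rw [probReal_univ, mul_one])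
  simpa using norm_image_sub_le hF (x + box ω) (y + box ω)

theorem norm_boxDeriv_sub_le (i : ℕ) (x y : C₀(ℕ, ℝ)) :
    ‖boxDeriv F i x - boxDeriv F i y‖ ≤ 2 / weight i * ‖x - y‖ := by
  rw [boxDeriv, boxDeriv, ← integral_sub (integrable_boxDeriv hF x i) (integrable_boxDeriv hF y i)]
  refine (norm_integral_le_of_norm_le_const (.of_forall fun ω => ?_)).trans_eq
    (by rw [probReal_univ, mul_one])
  have h := fun s => norm_image_sub_le hF (x + box (Function.update ω i s))
    (y + box (Function.update ω i s))
  simp only [add_sub_add_right_eq_sub] at h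
  rw [← smul_sub, sub_sub_sub_comm, norm_smul, Real.norm_of_nonneg (inv_nonneg.2 (weight_pos i).le)]
  calc _ ≤ (weight i)⁻¹ * (‖x - y‖ + ‖x - y‖) := by
        have := (weight_pos i).le
        gcongr
        exact (norm_sub_le _ _).trans (add_le_add (h 1) (h 0))
    _ = _ := by ring

theorem norm_boxAverage_add_sub_le [CompleteSpace Y] (i : ℕ) (x : C₀(ℕ, ℝ)) (t : ℝ) :
    ‖boxAverage F (x + t • unitVec i) - boxAverage F x - t • boxDeriv F i x‖ ≤
      2 / weight i * t ^ 2 := by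
  have hc : Continuous fun ω => F (x + t • unitVec i + box ω) - F (x + box ω) :=
    (hF.continuous.comp (continuous_const.add continuous_box)).sub
      (hF.continuous.comp (continuous_const.add continuous_box))
  have hc' : Integrable (fun ω => ∫ s : I, (F (x + t • unitVec i + box (Function.update ω i s)) -
      F (x + box (Function.update ω i s)))) cubeMeasure :=
    ((measurePreserving_update i).integrable_comp_of_integrable
      (integrable_cube hc)).integral_prod_left
  rw [boxAverage, boxAverage, boxDeriv,
    ← integral_sub (integrable_box hF _) (integrable_box hF x),
    integral_cube_eq_integral_update hc i, ← integral_smul,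
    ← integral_sub hc' ((integrable_boxDeriv hF x i).fun_smul t)]
  refine (norm_integral_le_of_norm_le_const (.of_forall fun ω => ?_)).trans_eq
    (by rw [probReal_univ, mul_one])
  have hg : ∀ u v : ℝ, ‖F (x + box (Function.update ω i 0) + u • unitVec i) -
      F (x + box (Function.update ω i 0) + v • unitVec i)‖ ≤ |u - v| := fun u v => by
    refine (norm_image_sub_le hF _ _).trans ?_
    rw [add_sub_add_left_eq_sub, show u • unitVec i - v • unitVec i = (u - v) • unitVec i from
      (sub_smul u v (unitVec i)).symm, norm_smul]
    exact mul_le_of_le_one_right (norm_nonneg _) (norm_unitVec_le i)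
  convert norm_integral_shift_sub_le hg (weight_pos i) t using 4
  · funext s
    rw [box_update ω i s, show (t + weight i * s) • unitVec i =
      t • unitVec i + (weight i * s : ℝ) • unitVec i from add_smul t (weight i * s) (unitVec i)]
    congr 2 <;> abel
  · rw [box_update ω i 1]
    simp [add_assoc]

theorem exists_norm_boxAverage_sum_sub_le [CompleteSpace Y] (b : ℕ → ℝ) (s : Finset ℕ) :
    ∃ C, ∀ h : ℝ, ‖boxAverage F (h • ∑ i ∈ s, b i • unitVec i) - boxAverage F 0 -
      h • ∑ i ∈ s, b i • boxDeriv F i 0‖ ≤ C * h ^ 2 := by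
  induction s using Finset.induction_on with
  | empty => exact ⟨0, fun h => by simp⟩
  | insert i s hi ih =>
    obtain ⟨C, hC⟩ := ih
    set v := ∑ i ∈ s, b i • unitVec i
    set w := ∑ i ∈ s, b i • boxDeriv F i 0
    refine ⟨C + 2 / weight i * b i ^ 2 + |b i| * (2 / weight i * ‖v‖), fun h => ?_⟩
    rw [Finset.sum_insert hi, Finset.sum_insert hi]
    have h1 := norm_boxAverage_add_sub_le hF i (h • v) (h * b i)
    have h2 := norm_boxDeriv_sub_le hF i (h • v) 0
    rw [sub_zero, norm_smul, Real.norm_eq_abs] at h2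
    have h3 : ‖(h * b i) • (boxDeriv F i (h • v) - boxDeriv F i 0)‖ ≤
        |h| * |b i| * (2 / weight i * (|h| * ‖v‖)) := by
      rw [norm_smul, Real.norm_eq_abs, abs_mul]
      gcongr
    have hv : h • (b i • unitVec i + v) = h • v + (h * b i) • unitVec i := by
      ext n
      simp only [ZeroAtInftyContinuousMap.add_apply, ZeroAtInftyContinuousMap.smul_apply,
        smul_eq_mul]
      ring
    have h4 : boxAverage F (h • (b i • unitVec i + v)) - boxAverage F 0 -
        h • (b i • boxDeriv F i 0 + w) =
        (boxAverage F (h • v) - boxAverage F 0 - h • w) +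
        (boxAverage F (h • v + (h * b i) • unitVec i) - boxAverage F (h • v) -
          (h * b i) • boxDeriv F i (h • v)) +
        (h * b i) • (boxDeriv F i (h • v) - boxDeriv F i 0) := by
      rw [hv]
      module
    rw [h4]
    refine (norm_add₃_le.trans (add_le_add (add_le_add (hC h) h1) h3)).trans_eq ?_
    linear_combination (|b i| * (2 / weight i * ‖v‖)) * abs_mul_abs_self h

theorem norm_sum_smul_boxDeriv_le [CompleteSpace Y] {b : ℕ → ℝ} {s : Finset ℕ} {M : ℝ}
    (hM : 0 ≤ M) (hb : ∀ i ∈ s, |b i| ≤ M) : ‖∑ i ∈ s, b i • boxDeriv F i 0‖ ≤ M := by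
  obtain ⟨C, hC⟩ := exists_norm_boxAverage_sum_sub_le hF b s
  set v := ∑ i ∈ s, b i • unitVec i with hv
  set w := ∑ i ∈ s, b i • boxDeriv F i 0
  have hvM : ‖v‖ ≤ M := (norm_le_iff hM).2 fun n => by
    rw [hv, sum_smul_unitVec_apply]
    split_ifs with h
    · exact hb n h
    · simpa using hM
  have hle : ∀ h : ℝ, 0 < h → ‖w‖ ≤ M + C * h := fun h hh => by
    have h1 := norm_boxAverage_sub_le hF (h • v) 0
    rw [sub_zero, norm_smul, Real.norm_of_nonneg hh.le] at h1
    have h2 := norm_sub_norm_le (h • w) (boxAverage F (h • v) - boxAverage F 0)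
    rw [norm_sub_rev (h • w), norm_smul, Real.norm_of_nonneg hh.le] at h2
    have h3 : h * ‖v‖ ≤ h * M := by gcongr
    refine le_of_mul_le_mul_left ?_ hh
    linarith [hC h]
  have ht : Tendsto (fun h : ℝ => M + C * h) (𝓝[>] 0) (𝓝 M) := by
    have hc : Continuous fun h : ℝ => M + C * h := by fun_prop
    simpa using (hc.tendsto 0).mono_left nhdsWithin_le_nhds
  exact ge_of_tendsto ht (eventually_nhdsWithin_of_forall hle)

theorem summable_smul_boxDeriv [CompleteSpace Y] (x : C₀(ℕ, ℝ)) :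
    Summable fun i => x i • boxDeriv F i 0 := by
  refine summable_iff_vanishing_norm.2 fun ε hε => ?_
  obtain ⟨N, hN⟩ := eventually_atTop.1 (Metric.tendsto_nhds.1 (tendsto_coe x) _ (half_pos hε))
  refine ⟨Finset.range N, fun t ht => ?_⟩
  refine (norm_sum_smul_boxDeriv_le hF (half_pos hε).le fun i hi => ?_).trans_lt
    (half_lt_self hε)
  have hi' : N ≤ i := not_lt.1 fun h => Finset.disjoint_left.1 ht hi (Finset.mem_range.2 h)
  simpa using (hN i hi').le

theorem apply_boxDeriv [CompleteSpace Y] {φ : StrongDual ℝ Y} {n : ℕ}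
    (hφ : ∀ x y, ‖x‖ ≤ 1 / 2 → ‖y‖ ≤ 1 / 2 → φ (F x - F y) = x n - y n) (i : ℕ) :
    φ (boxDeriv F i 0) = if n = i then 1 else 0 := by
  rw [boxDeriv, ← φ.integral_comp_comm (integrable_boxDeriv hF 0 i)]
  have h : ∀ ω, φ ((weight i)⁻¹ • (F (0 + box (Function.update ω i 1)) -
      F (0 + box (Function.update ω i 0)))) = if n = i then 1 else 0 := fun ω => by
    have hb : ∀ ω, ‖box ω‖ ≤ 1 / 2 := fun ω => (norm_box_le ω).trans (by norm_num)
    rw [map_smul, zero_add, zero_add, hφ _ _ (hb _) (hb _), box_update ω i 1]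
    have := (weight_pos i).ne'
    simp [unitVec_apply, this]
  rw [integral_congr_ae (.of_forall h)]
  simp

/-- A Lipschitz map which is inverted by coordinate functionals near `0` linearizes. -/
theorem nonempty_linearIsometry [CompleteSpace Y]
    (hφ : ∀ n, ∃ φ : StrongDual ℝ Y, ‖φ‖ ≤ 1 ∧
      ∀ x y, ‖x‖ ≤ 1 / 2 → ‖y‖ ≤ 1 / 2 → φ (F x - F y) = x n - y n) :
    Nonempty (C₀(ℕ, ℝ) →ₗᵢ[ℝ] Y) := by
  have hs := summable_smul_boxDeriv hF
  refine ⟨⟨⟨⟨fun x => ∑' i, x i • boxDeriv F i 0, fun x y => ?_⟩, fun c x => ?_⟩, fun x => ?_⟩⟩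
  · simp only [ZeroAtInftyContinuousMap.add_apply, add_smul]
    exact (hs x).tsum_add (hs y)
  · simp only [ZeroAtInftyContinuousMap.smul_apply, smul_eq_mul, mul_smul]
    exact (hs x).tsum_const_smul c
  · refine le_antisymm (le_of_tendsto (hs x).hasSum.norm (.of_forall fun s =>
      norm_sum_smul_boxDeriv_le hF (norm_nonneg x) fun i _ => abs_apply_le_norm x i)) ?_
    refine (norm_le_iff (norm_nonneg _)).2 fun n => ?_
    obtain ⟨φ, hφ1, hφ2⟩ := hφ n
    have hx : φ (∑' i, x i • boxDeriv F i 0) = x n := by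
      rw [φ.map_tsum (hs x), tsum_eq_single n fun i hi => by
        rw [map_smul, apply_boxDeriv hF hφ2, if_neg hi.symm, smul_zero]]
      rw [map_smul, apply_boxDeriv hF hφ2, if_pos rfl, smul_eq_mul, mul_one]
    rw [← hx]
    exact (φ.le_opNorm _).trans (mul_le_of_le_one_left (norm_nonneg _) hφ1)

end Lipschitz

end CZero

/-- Let `c₀ = C₀(ℕ, ℝ)` be the Banach space of real sequences converging to
`0` with the sup norm. If a real Banach space `Y` contains an isometric copy of the closed
unit ball of `c₀`, then `c₀` is linearly isometric to a subspace of `Y`. -/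
theorem stmt9 (Y : Type*) [NormedAddCommGroup Y] [NormedSpace ℝ Y] [CompleteSpace Y]
    (h : ∃ j : (Metric.closedBall (0 : C₀(ℕ, ℝ)) 1) → Y, Isometry j) :
    Nonempty (C₀(ℕ, ℝ) →ₗᵢ[ℝ] Y) := by
  obtain ⟨j, hj⟩ := h
  let F : C₀(ℕ, ℝ) → Y := fun x =>
    j ⟨CZero.clamp x, mem_closedBall_zero_iff.2 (CZero.norm_clamp_le x)⟩
  have hF : ∀ x y, ‖F x - F y‖ = ‖CZero.clamp x - CZero.clamp y‖ := fun x y => by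
    rw [← dist_eq_norm, hj.dist_eq, Subtype.dist_eq, dist_eq_norm]
  have hLip : LipschitzWith 1 F := LipschitzWith.of_dist_le_mul fun x y => by
    rw [dist_eq_norm, dist_eq_norm, hF, NNReal.coe_one, one_mul]
    exact CZero.norm_clamp_sub_le x y
  refine CZero.nonempty_linearIsometry hLip (CZero.exists_coordinate_functional fun x y hx hy => ?_)
  rw [hF, CZero.clamp_eq_self hx, CZero.clamp_eq_self hy]
end
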